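/- arXiv:0712.2471 — 2 statements merged into one kernel-verified Lean document; each statement's English description precedes it below -/
import Mathlib

section
/- If a quantum channel N is antidegradable, then its quantum capacity is zero: Q(N) = 0. -/
open scoped Matrix Kronecker ComplexOrder

/-- A finite family of Kraus operators from input space `A` to output space `B`. -/
structure KrausFamily (A B : Type) [Fintype A] [DecidableEq A] [Fintype B] [DecidableEq B] :
    Type 1 where
  ι : Type
  [fι : Fintype ι]
  [dι : DecidableEq ι]
  K : ι → Matrix B A ℂ

attribute [instance] KrausFamily.fι KrausFamily.dι

variable {A B : Type} [Fintype A] [DecidableEq A] [Fintype B] [DecidableEq B]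

/-- The trace-preservation condition `Σ Kᵢ† Kᵢ = 1` making a Kraus family a quantum channel. -/
def KrausFamily.IsChannel (N : KrausFamily A B) : Prop :=
  ∑ i, (N.K i)ᴴ * N.K i = 1

/-- The action of a channel: `N(ρ) = Σ Kᵢ ρ Kᵢ†`. -/
noncomputable def KrausFamily.apply (N : KrausFamily A B) (ρ : Matrix A A ℂ) : Matrix B B ℂ :=
  ∑ i, N.K i * ρ * (N.K i)ᴴ

/-- The complementary channel: `N̂(ρ)ᵢⱼ = Tr (Kᵢ ρ Kⱼ†)`. -/
noncomputable def KrausFamily.compl (N : KrausFamily A B) (ρ : Matrix A A ℂ) :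
    Matrix N.ι N.ι ℂ :=
  Matrix.of fun i j => (N.K i * ρ * (N.K j)ᴴ).trace

/-- Von Neumann entropy, base 2: `S(ρ) = −Σ λⱼ log₂ λⱼ` over the eigenvalues of `ρ`
(junk value `0` for non-Hermitian matrices). -/
noncomputable def vnEntropy {n : Type} [Fintype n] [DecidableEq n] (ρ : Matrix n n ℂ) : ℝ :=
  if h : ρ.IsHermitian then -∑ j, h.eigenvalues j * Real.logb 2 (h.eigenvalues j) else 0

/-- A density matrix: positive semidefinite with unit trace. -/
def IsDensity {n : Type} [Fintype n] (ρ : Matrix n n ℂ) : Prop :=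
  ρ.PosSemidef ∧ ρ.trace = 1

/-- Coherent information of `N` at input `φ`: `I^c(N,φ) = S(N(φ)) − S(N̂(φ))`. -/
noncomputable def cohInfo (N : KrausFamily A B) (φ : Matrix A A ℂ) : ℝ :=
  vnEntropy (N.apply φ) - vnEntropy (N.compl φ)

/-- One-shot quantum capacity: `Q^{(1)}(N) = sup_φ I^c(N,φ)` over density matrices `φ`. -/
noncomputable def Q1 (N : KrausFamily A B) : ℝ :=
  sSup {x | ∃ φ : Matrix A A ℂ, IsDensity φ ∧ x = cohInfo N φ}

/-- The `n`-th tensor power of a Kraus family, whose Kraus operators are all `n`-fold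
Kronecker products of Kraus operators of `N`. -/
noncomputable def KrausFamily.pow (N : KrausFamily A B) (n : ℕ) :
    KrausFamily (Fin n → A) (Fin n → B) where
  ι := Fin n → N.ι
  K f := Matrix.of fun b a => ∏ i, N.K (f i) (b i) (a i)

/-- Quantum capacity: `Q(N) = sup_{n ≥ 1} (1/n) Q^{(1)}(N^{⊗n})`. -/
noncomputable def Qcap (N : KrausFamily A B) : ℝ :=
  sSup {x | ∃ n : ℕ, 0 < n ∧ x = (1 / (n : ℝ)) * Q1 (N.pow n)}

/-- `N` is degradable if some channel `D` maps its output to its complementary output. -/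
def KrausFamily.IsDegradable (N : KrausFamily A B) : Prop :=
  ∃ D : KrausFamily B N.ι, D.IsChannel ∧ ∀ ρ : Matrix A A ℂ, D.apply (N.apply ρ) = N.compl ρ

/-- `N` is antidegradable if some channel `D` maps its complementary output to its output. -/
def KrausFamily.IsAntidegradable (N : KrausFamily A B) : Prop :=
  ∃ D : KrausFamily N.ι B, D.IsChannel ∧ ∀ ρ : Matrix A A ℂ, D.apply (N.compl ρ) = N.apply ρ
/-! ### Data processing for the relative entropy -/
section dpi
variable {m n : Type} [Fintype m] [DecidableEq m] [Fintype n] [DecidableEq n]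

/-- The Heisenberg-picture dual of a Kraus family. -/
noncomputable def KrausFamily.dual (D : KrausFamily m n) (X : Matrix n n ℂ) : Matrix m m ℂ :=
  ∑ i, (D.K i)ᴴ * X * D.K i

theorem KrausFamily.dual_conjTranspose (D : KrausFamily m n) (X : Matrix n n ℂ) :
    D.dual Xᴴ = (D.dual X)ᴴ := by
  simp [KrausFamily.dual, Matrix.conjTranspose_sum, Matrix.conjTranspose_mul, Matrix.mul_assoc]

theorem KrausFamily.trace_mul_dual (D : KrausFamily m n) (ρ : Matrix m m ℂ) (X : Matrix n n ℂ) :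
    (ρ * D.dual X).trace = (D.apply ρ * X).trace := by
  simp only [KrausFamily.dual, KrausFamily.apply, Finset.mul_sum, Finset.sum_mul,
    Matrix.trace_sum]
  refine Finset.sum_congr rfl fun i _ => ?_
  rw [Matrix.mul_assoc (D.K i), Matrix.mul_assoc (D.K i), Matrix.trace_mul_comm (D.K i)]
  simp only [Matrix.mul_assoc]

theorem KrausFamily.IsChannel.trace_apply {D : KrausFamily m n} (hD : D.IsChannel)
    (ρ : Matrix m m ℂ) : (D.apply ρ).trace = ρ.trace := by
  have h := D.trace_mul_dual ρ 1
  have h1 : D.dual 1 = 1 := by simpa [KrausFamily.dual] using (show ∑ i, (D.K i)ᴴ * D.K i = 1 from hD)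
  rw [h1, Matrix.mul_one, Matrix.mul_one] at h
  exact h.symm

/-- The Kadison–Schwarz inequality, tested against a positive semidefinite matrix. -/
theorem KrausFamily.IsChannel.trace_dual_mul_le {D : KrausFamily m n} (hD : D.IsChannel)
    {ρ : Matrix m m ℂ} (hρ : ρ.PosSemidef) (X : Matrix n n ℂ) :
    (ρ * (D.dual X * (D.dual X)ᴴ)).trace.re ≤ (D.apply ρ * (X * Xᴴ)).trace.re := by
  rw [← D.trace_mul_dual]
  set Y := D.dual X with hY
  have hY' : D.dual Xᴴ = Yᴴ := D.dual_conjTranspose X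
  have key : D.dual (X * Xᴴ) - Y * Yᴴ =
      ∑ i, (Xᴴ * D.K i - D.K i * Yᴴ)ᴴ * (Xᴴ * D.K i - D.K i * Yᴴ) := by
    have : ∀ i, (Xᴴ * D.K i - D.K i * Yᴴ)ᴴ * (Xᴴ * D.K i - D.K i * Yᴴ) =
        (D.K i)ᴴ * (X * Xᴴ) * D.K i - ((D.K i)ᴴ * X * D.K i) * Yᴴ
          - Y * ((D.K i)ᴴ * Xᴴ * D.K i) + Y * ((D.K i)ᴴ * D.K i) * Yᴴ := by
      intro i
      simp only [Matrix.conjTranspose_sub, Matrix.conjTranspose_mul,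
        Matrix.conjTranspose_conjTranspose, Matrix.sub_mul, Matrix.mul_sub, Matrix.mul_assoc]
      abel
    simp only [this, Finset.sum_add_distrib, Finset.sum_sub_distrib, ← Finset.sum_mul,
      ← Finset.mul_sum]
    have e1 : ∑ i, (D.K i)ᴴ * X * D.K i = Y := rfl
    have e2 : ∑ i, (D.K i)ᴴ * Xᴴ * D.K i = Yᴴ := hY'
    have e3 : ∑ i, (D.K i)ᴴ * D.K i = 1 := hD
    rw [e1, e2, e3, Matrix.mul_one]
    simp [KrausFamily.dual]
  have h0 : 0 ≤ (ρ * (D.dual (X * Xᴴ) - Y * Yᴴ)).trace := by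
    rw [key, Finset.mul_sum, Matrix.trace_sum]
    refine Finset.sum_nonneg fun i _ => ?_
    rw [← Matrix.mul_assoc, Matrix.trace_mul_comm, ← Matrix.mul_assoc]
    exact (hρ.mul_mul_conjTranspose_same _).trace_nonneg
  have h1 := (Complex.le_def.1 h0).1
  rw [Matrix.mul_sub, Matrix.trace_sub, Complex.sub_re, Complex.zero_re] at h1
  linarith

/-- Spectral data for a matrix: a unitary change of basis and real, nonnegative eigenvalues. -/
structure IsDiagonalization (ρ U : Matrix m m ℂ) (p : m → ℝ) : Prop where
  mul_star : U * Uᴴ = 1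
  nonneg : ∀ i, 0 ≤ p i
  eq : ρ = U * Matrix.diagonal (fun i => (p i : ℂ)) * Uᴴ

/-- The squared overlaps of two orthonormal bases. -/
noncomputable def overlap (U W : Matrix m m ℂ) (j i : m) : ℝ := ‖(Wᴴ * U) j i‖ ^ 2

/-- The value at `t` of `⟨ρ, (L_σ + t R_ρ)⁻¹ ρ⟩` in spectral coordinates. -/
noncomputable def quasiEntropy (U W : Matrix m m ℂ) (p q : m → ℝ) (t : ℝ) : ℝ :=
  ∑ j, ∑ i, overlap U W j i * (p i ^ 2 / (q j + t * p i))

theorem IsDiagonalization.star_mul {ρ U : Matrix m m ℂ} {p : m → ℝ}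
    (h : IsDiagonalization ρ U p) : Uᴴ * U = 1 := mul_eq_one_comm.1 h.mul_star

theorem IsDiagonalization.posSemidef {ρ U : Matrix m m ℂ} {p : m → ℝ}
    (h : IsDiagonalization ρ U p) : ρ.PosSemidef := by
  rw [h.eq]
  refine Matrix.PosSemidef.mul_mul_conjTranspose_same ?_ _
  exact Matrix.PosSemidef.diagonal fun i => by simpa using h.nonneg i

/-- The quadratic functional whose supremum over `X` is the quasi-entropy. -/
noncomputable def quadForm (ρ σ : Matrix m m ℂ) (t : ℝ) (X : Matrix m m ℂ) : ℝ :=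
  2 * (ρ * Xᴴ).trace.re - (σ * (X * Xᴴ)).trace.re - t * (ρ * (Xᴴ * X)).trace.re

theorem quadForm_eq {ρ σ U W : Matrix m m ℂ} {p q : m → ℝ}
    (hρ : IsDiagonalization ρ U p) (hσ : IsDiagonalization σ W q) (t : ℝ) (Y : Matrix m m ℂ) :
    quadForm ρ σ t (W * Y * Uᴴ) = ∑ j, ∑ i,
      (2 * (starRingEnd ℂ (Y j i) * (Wᴴ * U) j i).re * p i - (q j + t * p i) * ‖Y j i‖ ^ 2) := by
  have e1 : (ρ * (W * Y * Uᴴ)ᴴ).trace.re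
      = ∑ j, ∑ i, (starRingEnd ℂ (Y j i) * (Wᴴ * U) j i).re * p i := by
    have : (ρ * (W * Y * Uᴴ)ᴴ).trace
        = ((Wᴴ * U) * Matrix.diagonal (fun i => (p i : ℂ)) * Yᴴ).trace := by
      rw [hρ.eq]
      simp only [Matrix.conjTranspose_mul, Matrix.conjTranspose_conjTranspose]
      have : U * Matrix.diagonal (fun i => (p i : ℂ)) * Uᴴ * (U * (Yᴴ * Wᴴ))
          = U * Matrix.diagonal (fun i => (p i : ℂ)) * (Uᴴ * U) * Yᴴ * Wᴴ := by
        simp only [Matrix.mul_assoc]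
      rw [this, hρ.star_mul, Matrix.mul_one, Matrix.trace_mul_comm]
      simp only [Matrix.mul_assoc]
    rw [this, Matrix.trace, Complex.re_sum]
    refine Finset.sum_congr rfl fun j _ => ?_
    rw [Matrix.diag_apply, Matrix.mul_apply, Complex.re_sum]
    refine Finset.sum_congr rfl fun i _ => ?_
    rw [Matrix.mul_diagonal, Matrix.conjTranspose_apply, ← Complex.re_mul_ofReal]
    congr 1
    simp only [RCLike.star_def]
    ring
  have e2 : (σ * ((W * Y * Uᴴ) * (W * Y * Uᴴ)ᴴ)).trace.re = ∑ j, ∑ i, q j * ‖Y j i‖ ^ 2 := by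
    have : (σ * ((W * Y * Uᴴ) * (W * Y * Uᴴ)ᴴ)).trace
        = (Matrix.diagonal (fun i => (q i : ℂ)) * (Y * Yᴴ)).trace := by
      rw [hσ.eq]
      simp only [Matrix.conjTranspose_mul, Matrix.conjTranspose_conjTranspose]
      have : W * Matrix.diagonal (fun i => (q i : ℂ)) * Wᴴ * (W * Y * Uᴴ * (U * (Yᴴ * Wᴴ)))
          = W * (Matrix.diagonal (fun i => (q i : ℂ)) * (Wᴴ * W) * Y * (Uᴴ * U) * Yᴴ * Wᴴ) := by
        simp only [Matrix.mul_assoc]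
      rw [this, hρ.star_mul, hσ.star_mul, Matrix.trace_mul_comm, Matrix.mul_assoc _ Wᴴ,
        hσ.star_mul]
      simp only [Matrix.mul_assoc, Matrix.mul_one]
    rw [this, Matrix.trace, Complex.re_sum]
    refine Finset.sum_congr rfl fun j _ => ?_
    rw [Matrix.diag_apply, Matrix.diagonal_mul, Matrix.mul_apply, Finset.mul_sum, Complex.re_sum]
    refine Finset.sum_congr rfl fun i _ => ?_
    rw [Matrix.conjTranspose_apply, Complex.re_ofReal_mul, RCLike.star_def, Complex.mul_conj,
      Complex.normSq_eq_norm_sq, Complex.ofReal_re]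
  have e3 : (ρ * ((W * Y * Uᴴ)ᴴ * (W * Y * Uᴴ))).trace.re = ∑ j, ∑ i, p i * ‖Y j i‖ ^ 2 := by
    have : (ρ * ((W * Y * Uᴴ)ᴴ * (W * Y * Uᴴ))).trace
        = (Matrix.diagonal (fun i => (p i : ℂ)) * (Yᴴ * Y)).trace := by
      rw [hρ.eq]
      simp only [Matrix.conjTranspose_mul, Matrix.conjTranspose_conjTranspose]
      have : U * Matrix.diagonal (fun i => (p i : ℂ)) * Uᴴ * (U * (Yᴴ * Wᴴ) * (W * Y * Uᴴ))
          = U * (Matrix.diagonal (fun i => (p i : ℂ)) * (Uᴴ * U) * Yᴴ * (Wᴴ * W) * Y * Uᴴ) := by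
        simp only [Matrix.mul_assoc]
      rw [this, hρ.star_mul, hσ.star_mul, Matrix.trace_mul_comm, Matrix.mul_assoc _ Uᴴ,
        hρ.star_mul]
      simp only [Matrix.mul_assoc, Matrix.mul_one]
    rw [this, Matrix.trace, Complex.re_sum, Finset.sum_comm]
    refine Finset.sum_congr rfl fun j _ => ?_
    rw [Matrix.diag_apply, Matrix.diagonal_mul, Matrix.mul_apply, Finset.mul_sum, Complex.re_sum]
    refine Finset.sum_congr rfl fun i _ => ?_
    rw [Matrix.conjTranspose_apply, Complex.re_ofReal_mul, mul_comm (star _), RCLike.star_def,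
      Complex.mul_conj, Complex.normSq_eq_norm_sq, Complex.ofReal_re]
  rw [quadForm, e1, e2, e3]
  simp only [Finset.mul_sum, ← Finset.sum_sub_distrib]
  refine Finset.sum_congr rfl fun j _ => Finset.sum_congr rfl fun i _ => ?_
  ring

theorem quadForm_le_quasiEntropy {ρ σ U W : Matrix m m ℂ} {p q : m → ℝ}
    (hρ : IsDiagonalization ρ U p) (hσ : IsDiagonalization σ W q) {t : ℝ} (ht : 0 < t)
    (X : Matrix m m ℂ) : quadForm ρ σ t X ≤ quasiEntropy U W p q t := by
  have hX : X = W * (Wᴴ * X * U) * Uᴴ := by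
    have : W * (Wᴴ * X * U) * Uᴴ = (W * Wᴴ) * X * (U * Uᴴ) := by simp only [Matrix.mul_assoc]
    rw [this, hρ.mul_star, hσ.mul_star, Matrix.one_mul, Matrix.mul_one]
  rw [hX, quadForm_eq hρ hσ, quasiEntropy]
  refine Finset.sum_le_sum fun j _ => Finset.sum_le_sum fun i _ => ?_
  generalize (Wᴴ * X * U) j i = y
  rw [overlap]
  generalize (Wᴴ * U) j i = z
  have hp := hρ.nonneg i
  have hq := hσ.nonneg j
  have hre : (starRingEnd ℂ y * z).re ≤ ‖y‖ * ‖z‖ := by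
    refine (Complex.re_le_norm _).trans ?_
    rw [norm_mul, RCLike.norm_conj]
  rcases hp.eq_or_lt with h0 | h0
  · rw [← h0]
    have := mul_nonneg hq (sq_nonneg ‖y‖)
    simp only [mul_zero, add_zero]
    norm_num
    exact this
  · have hs : 0 < q j + t * p i := by positivity
    rw [← mul_div_assoc, le_div_iff₀ hs]
    have h2 : (starRingEnd ℂ y * z).re * p i ≤ ‖y‖ * ‖z‖ * p i :=
      mul_le_mul_of_nonneg_right hre hp
    nlinarith [sq_nonneg ((q j + t * p i) * ‖y‖ - ‖z‖ * p i),
      mul_le_mul_of_nonneg_right h2 hs.le]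

theorem exists_quadForm_eq_quasiEntropy {ρ σ U W : Matrix m m ℂ} {p q : m → ℝ}
    (hρ : IsDiagonalization ρ U p) (hσ : IsDiagonalization σ W q) {t : ℝ} (ht : 0 < t) :
    ∃ X, quadForm ρ σ t X = quasiEntropy U W p q t := by
  refine ⟨W * (Matrix.of fun j i => ((p i / (q j + t * p i) : ℝ) : ℂ) * (Wᴴ * U) j i) * Uᴴ, ?_⟩
  rw [quadForm_eq hρ hσ, quasiEntropy]
  refine Finset.sum_congr rfl fun j _ => Finset.sum_congr rfl fun i _ => ?_
  rw [overlap, Matrix.of_apply]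
  generalize (Wᴴ * U) j i = z
  have hp := hρ.nonneg i
  have hq := hσ.nonneg j
  rw [map_mul, Complex.conj_ofReal, mul_assoc (Complex.ofReal _),
    Complex.re_ofReal_mul, norm_mul, Complex.norm_real,
    mul_pow, Real.norm_eq_abs, sq_abs, mul_comm (starRingEnd ℂ z), Complex.mul_conj,
    Complex.normSq_eq_norm_sq, Complex.ofReal_re]
  rcases hp.eq_or_lt with h0 | h0
  · simp [← h0]
  · have hs : 0 < q j + t * p i := by positivity
    field_simp
    ring

theorem KrausFamily.IsChannel.quasiEntropy_le {D : KrausFamily m n} (hD : D.IsChannel)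
    {ρ σ U W : Matrix m m ℂ} {p q : m → ℝ} {U' W' : Matrix n n ℂ} {p' q' : n → ℝ}
    (hρ : IsDiagonalization ρ U p) (hσ : IsDiagonalization σ W q)
    (hρ' : IsDiagonalization (D.apply ρ) U' p') (hσ' : IsDiagonalization (D.apply σ) W' q')
    {t : ℝ} (ht : 0 < t) : quasiEntropy U' W' p' q' t ≤ quasiEntropy U W p q t := by
  obtain ⟨X, hX⟩ := exists_quadForm_eq_quasiEntropy hρ' hσ' ht
  rw [← hX]
  refine le_trans ?_ (quadForm_le_quasiEntropy hρ hσ ht (D.dual X))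
  have h1 := hD.trace_dual_mul_le hσ.posSemidef X
  have h2 := hD.trace_dual_mul_le hρ.posSemidef Xᴴ
  rw [D.dual_conjTranspose, Matrix.conjTranspose_conjTranspose,
    Matrix.conjTranspose_conjTranspose] at h2
  have h3 := D.trace_mul_dual ρ Xᴴ
  rw [D.dual_conjTranspose] at h3
  rw [quadForm, quadForm, h3]
  nlinarith

/-- The interpolating function `∑ |⟨j|i⟩|² pᵢ log (qⱼ + t pᵢ)`, equal to `Tr ρ log σ` at `t = 0`. -/
noncomputable def crossLog (U W : Matrix m m ℂ) (p q : m → ℝ) (t : ℝ) : ℝ :=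
  ∑ j, ∑ i, overlap U W j i * p i * Real.log (q j + t * p i)

omit [DecidableEq m] in
theorem hasDerivAt_crossLog {U W : Matrix m m ℂ} {p q : m → ℝ} (hp : ∀ i, 0 ≤ p i)
    (hq : ∀ j, 0 ≤ q j) {t : ℝ} (ht : 0 < t) :
    HasDerivAt (crossLog U W p q) (quasiEntropy U W p q t) t := by
  unfold crossLog quasiEntropy
  refine HasDerivAt.fun_sum fun j _ => HasDerivAt.fun_sum fun i _ => ?_
  rcases (hp i).eq_or_lt with h0 | h0
  · simpa [← h0] using hasDerivAt_const t (0 : ℝ)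
  · have hs : 0 < q j + t * p i := by have := hq j; positivity
    have h1 : HasDerivAt (fun t : ℝ => q j + t * p i) (p i) t := by
      simpa using ((hasDerivAt_id t).mul_const (p i)).const_add (q j)
    have h2 := (h1.log hs.ne').const_mul (overlap U W j i * p i)
    rwa [show overlap U W j i * p i * (p i / (q j + t * p i)) =
      overlap U W j i * (p i ^ 2 / (q j + t * p i)) by ring] at h2

omit [DecidableEq m] in
theorem tendsto_crossLog_zero {U W : Matrix m m ℂ} {p q : m → ℝ}
    (hsupp : ∀ j i, q j = 0 → overlap U W j i * p i = 0) :
    Filter.Tendsto (crossLog U W p q) (nhdsWithin 0 (Set.Ioi 0))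
      (nhds (∑ j, ∑ i, overlap U W j i * p i * Real.log (q j))) := by
  unfold crossLog
  refine tendsto_finsetSum _ fun j _ => tendsto_finsetSum _ fun i _ => ?_
  by_cases h0 : q j = 0
  · simp only [hsupp j i h0, zero_mul]
    exact tendsto_const_nhds
  · refine Filter.Tendsto.const_mul _ (Filter.Tendsto.log ?_ h0)
    refine Filter.Tendsto.mono_left ?_ nhdsWithin_le_nhds
    have : Continuous fun t : ℝ => q j + t * p i := by fun_prop
    simpa using this.tendsto 0

theorem sum_overlap {U W : Matrix m m ℂ} (hU : Uᴴ * U = 1) (hW : W * Wᴴ = 1) (i : m) :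
    ∑ j, overlap U W j i = 1 := by
  have h : ((Wᴴ * U)ᴴ * (Wᴴ * U)) i i = 1 := by
    have : (Wᴴ * U)ᴴ * (Wᴴ * U) = Uᴴ * (W * Wᴴ) * U := by
      simp only [Matrix.conjTranspose_mul, Matrix.conjTranspose_conjTranspose, Matrix.mul_assoc]
    rw [this, hW, Matrix.mul_one, hU, Matrix.one_apply_eq]
  rw [Matrix.mul_apply] at h
  have h' := congrArg Complex.re h
  rw [Complex.re_sum, Complex.one_re] at h'
  rw [← h']
  refine Finset.sum_congr rfl fun j _ => ?_
  rw [Matrix.conjTranspose_apply, mul_comm, RCLike.star_def, Complex.mul_conj,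
    Complex.normSq_eq_norm_sq, Complex.ofReal_re, overlap]

theorem sum_overlap_mul {U W : Matrix m m ℂ} (hU : Uᴴ * U = 1) (hW : W * Wᴴ = 1) (f : m → ℝ) :
    ∑ j, ∑ i, overlap U W j i * f i = ∑ i, f i := by
  rw [Finset.sum_comm]
  simp only [← Finset.sum_mul, sum_overlap hU hW, one_mul]

theorem tendsto_crossLog_atTop {U W : Matrix m m ℂ} {p q : m → ℝ} (hU : Uᴴ * U = 1)
    (hW : W * Wᴴ = 1) (hp : ∀ i, 0 ≤ p i) (hq : ∀ j, 0 ≤ q j) :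
    Filter.Tendsto (fun t => crossLog U W p q t - (∑ i, p i) * Real.log t) Filter.atTop
      (nhds (∑ i, p i * Real.log (p i))) := by
  rw [← sum_overlap_mul hU hW p, ← sum_overlap_mul hU hW (fun i => p i * Real.log (p i))]
  simp only [crossLog, Finset.sum_mul, ← Finset.sum_sub_distrib]
  refine tendsto_finsetSum _ fun j _ => tendsto_finsetSum _ fun i _ => ?_
  rcases (hp i).eq_or_lt with h0 | h0
  · simp [← h0]
  · have h1 : Filter.Tendsto (fun t : ℝ => q j / t + p i) Filter.atTop (nhds (p i)) := by
      simpa using (Filter.Tendsto.const_div_atTop Filter.tendsto_id (q j)).add_const (p i)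
    have h2 := (h1.log h0.ne').const_mul (overlap U W j i * p i)
    rw [← mul_assoc]
    refine h2.congr' ?_
    filter_upwards [Filter.eventually_gt_atTop 0] with t ht
    have hs : 0 < q j + t * p i := by have := hq j; positivity
    rw [← mul_sub, ← Real.log_div hs.ne' ht.ne']
    congr 2
    field_simp

/-- Data processing for the relative entropy, in spectral coordinates. -/
theorem KrausFamily.IsChannel.relEntropy_le {D : KrausFamily m n} (hD : D.IsChannel)
    {ρ σ U W : Matrix m m ℂ} {p q : m → ℝ} {U' W' : Matrix n n ℂ} {p' q' : n → ℝ}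
    (hρ : IsDiagonalization ρ U p) (hσ : IsDiagonalization σ W q)
    (hρ' : IsDiagonalization (D.apply ρ) U' p') (hσ' : IsDiagonalization (D.apply σ) W' q')
    (hsupp : ∀ j i, q j = 0 → overlap U W j i * p i = 0)
    (hsupp' : ∀ j i, q' j = 0 → overlap U' W' j i * p' i = 0)
    (hsum : ∑ i, p' i = ∑ i, p i) :
    ∑ i, p' i * Real.log (p' i) - ∑ j, ∑ i, overlap U' W' j i * p' i * Real.log (q' j) ≤
      ∑ i, p i * Real.log (p i) - ∑ j, ∑ i, overlap U W j i * p i * Real.log (q j) := by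
  set H : ℝ → ℝ := fun t => crossLog U W p q t - crossLog U' W' p' q' t with hH
  have hderiv : ∀ t, 0 < t →
      HasDerivAt H (quasiEntropy U W p q t - quasiEntropy U' W' p' q' t) t := fun t ht =>
    (hasDerivAt_crossLog hρ.nonneg hσ.nonneg ht).sub
      (hasDerivAt_crossLog hρ'.nonneg hσ'.nonneg ht)
  have hmono : MonotoneOn H (Set.Ioi 0) := by
    refine monotoneOn_of_deriv_nonneg (convex_Ioi 0)
      (fun t ht => (hderiv t ht).continuousAt.continuousWithinAt) ?_ ?_
    · rw [interior_Ioi]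
      exact fun t ht => (hderiv t ht).differentiableAt.differentiableWithinAt
    · rw [interior_Ioi]
      intro t ht
      rw [(hderiv t ht).deriv]
      exact sub_nonneg.2 (hD.quasiEntropy_le hρ hσ hρ' hσ' ht)
  have htop : Filter.Tendsto H Filter.atTop
      (nhds (∑ i, p i * Real.log (p i) - ∑ i, p' i * Real.log (p' i))) := by
    refine ((tendsto_crossLog_atTop hρ.star_mul hσ.mul_star hρ.nonneg hσ.nonneg).sub
      (tendsto_crossLog_atTop hρ'.star_mul hσ'.mul_star hρ'.nonneg hσ'.nonneg)).congr fun t => ?_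
    rw [hsum, hH]
    ring
  have hzero : Filter.Tendsto H (nhdsWithin 0 (Set.Ioi 0)) _ :=
    (tendsto_crossLog_zero hsupp).sub (tendsto_crossLog_zero hsupp')
  have hle : ∀ s, 0 < s → H s ≤ ∑ i, p i * Real.log (p i) - ∑ i, p' i * Real.log (p' i) := by
    intro s hs
    refine ge_of_tendsto htop ?_
    filter_upwards [Filter.eventually_ge_atTop s] with t ht
    exact hmono hs (hs.trans_le ht) ht
  have := le_of_tendsto hzero (by
    filter_upwards [self_mem_nhdsWithin] with s hs using hle s hs)
  linarith

/-! ### Entropy via spectral data -/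

theorem Matrix.PosSemidef.exists_isDiagonalization {ρ : Matrix m m ℂ} (hρ : ρ.PosSemidef) :
    ∃ U p, IsDiagonalization ρ U p := by
  refine ⟨hρ.isHermitian.eigenvectorUnitary, hρ.isHermitian.eigenvalues, ?_,
    hρ.eigenvalues_nonneg, ?_⟩
  · exact Unitary.mul_star_self_of_mem hρ.isHermitian.eigenvectorUnitary.2
  · conv_lhs => rw [hρ.isHermitian.spectral_theorem]
    rfl

/-- The contribution `-x log₂ x` of an eigenvalue to the von Neumann entropy. -/
noncomputable def entropyTerm (z : ℂ) : ℝ := -(z.re * Real.logb 2 z.re)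

theorem vnEntropy_eq_roots {ρ : Matrix m m ℂ} (hρ : ρ.IsHermitian) :
    vnEntropy ρ = (ρ.charpoly.roots.map entropyTerm).sum := by
  rw [vnEntropy, dif_pos hρ, hρ.roots_charpoly_eq_eigenvalues, Multiset.map_map,
    ← Finset.sum_neg_distrib]
  rfl

theorem vnEntropy_transpose {ρ : Matrix m m ℂ} (hρ : ρ.IsHermitian) :
    vnEntropy ρᵀ = vnEntropy ρ := by
  rw [vnEntropy_eq_roots hρ, vnEntropy_eq_roots hρ.transpose, Matrix.charpoly_transpose]

theorem IsDiagonalization.vnEntropy_eq {ρ U : Matrix m m ℂ} {p : m → ℝ}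
    (h : IsDiagonalization ρ U p) :
    vnEntropy ρ = -(∑ i, p i * Real.log (p i)) / Real.log 2 := by
  have hc : ρ.charpoly = (Matrix.diagonal fun i => (p i : ℂ)).charpoly := by
    rw [h.eq, Matrix.charpoly_mul_comm, ← Matrix.mul_assoc, h.star_mul, Matrix.one_mul]
  rw [vnEntropy_eq_roots h.posSemidef.isHermitian, hc, Matrix.charpoly_diagonal,
    Polynomial.roots_prod _ _ (Finset.prod_ne_zero_iff.2 fun i _ => Polynomial.X_sub_C_ne_zero _)]
  simp only [Polynomial.roots_X_sub_C, Multiset.bind_singleton, Multiset.map_map]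
  change ∑ i, entropyTerm (p i) = _
  simp only [entropyTerm, Complex.ofReal_re, Real.logb, Finset.sum_neg_distrib, neg_div,
    Finset.sum_div, mul_div_assoc]

theorem vnEntropy_mul_conjTranspose (M : Matrix m n ℂ) :
    vnEntropy (M * Mᴴ) = vnEntropy (Mᴴ * M) := by
  rw [vnEntropy_eq_roots (Matrix.isHermitian_mul_conjTranspose_self M),
    vnEntropy_eq_roots (Matrix.isHermitian_conjTranspose_mul_self M)]
  have h := congrArg (fun P => (P.roots.map entropyTerm).sum) (Matrix.charpoly_mul_comm' M Mᴴ)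
  have h0 : entropyTerm 0 = 0 := by simp [entropyTerm]
  have hX : ∀ k : ℕ, (Polynomial.X : Polynomial ℂ) ^ k ≠ 0 := fun k =>
    pow_ne_zero _ Polynomial.X_ne_zero
  simpa only [Polynomial.roots_mul (mul_ne_zero (hX _) (Matrix.charpoly_monic _).ne_zero),
    Polynomial.roots_pow, Polynomial.roots_X, Multiset.map_add, Multiset.sum_add,
    Multiset.map_nsmul, Multiset.map_singleton, Multiset.sum_nsmul, Multiset.sum_singleton, h0,
    smul_zero, zero_add] using h

theorem IsDiagonalization.sum_eq_trace {ρ U : Matrix m m ℂ} {p : m → ℝ}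
    (h : IsDiagonalization ρ U p) : ∑ i, p i = ρ.trace.re := by
  rw [h.eq, Matrix.trace_mul_comm, ← Matrix.mul_assoc, h.star_mul, Matrix.one_mul,
    Matrix.trace_diagonal, Complex.re_sum]
  rfl

/-! ### Conditional entropy -/

/-- The `(r, s)` block of a bipartite matrix. -/
def bipartiteBlock {R : Type} (ρ : Matrix (R × m) (R × m) ℂ) (r s : R) : Matrix m m ℂ :=
  Matrix.of fun i j => ρ (r, i) (s, j)

section bipartite
variable {R : Type} [Fintype R] [DecidableEq R]

/-- The partial trace over the first factor. -/
noncomputable def traceLeft (ρ : Matrix (R × m) (R × m) ℂ) : Matrix m m ℂ :=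
  ∑ r, bipartiteBlock ρ r r

/-- The Kraus family acting as `D` on the second factor and trivially on the first. -/
noncomputable def KrausFamily.idTensor (R : Type) [Fintype R] [DecidableEq R]
    (D : KrausFamily m n) : KrausFamily (R × m) (R × n) where
  ι := D.ι
  K i := (1 : Matrix R R ℂ) ⊗ₖ D.K i

theorem KrausFamily.IsChannel.idTensor {D : KrausFamily m n} (hD : D.IsChannel) :
    (D.idTensor R).IsChannel := by
  change ∑ i : D.ι, ((1 : Matrix R R ℂ) ⊗ₖ D.K i)ᴴ * ((1 : Matrix R R ℂ) ⊗ₖ D.K i) = 1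
  simp only [Matrix.conjTranspose_kronecker, ← Matrix.mul_kronecker_mul,
    Matrix.conjTranspose_one, Matrix.mul_one]
  have : ∑ i : D.ι, (1 : Matrix R R ℂ) ⊗ₖ ((D.K i)ᴴ * D.K i)
      = (1 : Matrix R R ℂ) ⊗ₖ ∑ i : D.ι, ((D.K i)ᴴ * D.K i) :=
    (map_sum (Matrix.kroneckerBilinear (R := ℂ) (α := ℂ) (1 : Matrix R R ℂ)) _ _).symm
  rw [this, show ∑ i : D.ι, (D.K i)ᴴ * D.K i = 1 from hD, Matrix.one_kronecker_one]

theorem KrausFamily.apply_apply (D : KrausFamily m n) (ρ : Matrix m m ℂ) (b b' : n) :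
    D.apply ρ b b' = ∑ k, ∑ a', ∑ a, D.K k b a * ρ a a' * starRingEnd ℂ (D.K k b' a') := by
  simp only [KrausFamily.apply, Matrix.sum_apply, Matrix.mul_apply, Finset.sum_mul,
    Matrix.conjTranspose_apply, RCLike.star_def]

theorem KrausFamily.idTensor_apply (D : KrausFamily m n) (ρ : Matrix (R × m) (R × m) ℂ)
    (r s : R) (b b' : n) :
    (D.idTensor R).apply ρ (r, b) (s, b') = D.apply (bipartiteBlock ρ r s) b b' := by
  rw [KrausFamily.apply_apply, KrausFamily.apply_apply]
  change ∑ k : D.ι, _ = _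
  refine Finset.sum_congr rfl fun k _ => ?_
  simp only [KrausFamily.idTensor, Fintype.sum_prod_type, Matrix.kroneckerMap_apply,
    Matrix.one_apply, bipartiteBlock, Matrix.of_apply]
  rw [Finset.sum_eq_single s]
  · refine Finset.sum_congr rfl fun a' _ => ?_
    rw [Finset.sum_eq_single r]
    · simp
    · intro r' _ h
      simp [h.symm]
    · simp
  · intro s' _ h
    simp [h.symm]
  · simp

theorem bipartiteBlock_idTensor_apply (D : KrausFamily m n) (ρ : Matrix (R × m) (R × m) ℂ)
    (r s : R) :
    bipartiteBlock ((D.idTensor R).apply ρ) r s = D.apply (bipartiteBlock ρ r s) := by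
  ext b b'
  exact D.idTensor_apply ρ r s b b'

theorem KrausFamily.apply_sum (D : KrausFamily m n) {α : Type} (s : Finset α)
    (f : α → Matrix m m ℂ) : D.apply (∑ x ∈ s, f x) = ∑ x ∈ s, D.apply (f x) := by
  simp only [KrausFamily.apply, Matrix.mul_sum, Matrix.sum_mul]
  exact Finset.sum_comm

theorem traceLeft_idTensor_apply (D : KrausFamily m n) (ρ : Matrix (R × m) (R × m) ℂ) :
    traceLeft ((D.idTensor R).apply ρ) = D.apply (traceLeft ρ) := by
  simp only [traceLeft, bipartiteBlock_idTensor_apply, D.apply_sum]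

omit [Fintype m] [DecidableEq m] [Fintype R] in
theorem bipartiteBlock_one_kronecker (σ : Matrix m m ℂ) (r s : R) :
    bipartiteBlock ((1 : Matrix R R ℂ) ⊗ₖ σ) r s = if r = s then σ else 0 := by
  ext i j
  by_cases h : r = s <;> simp [bipartiteBlock, Matrix.kroneckerMap_apply, h]

theorem KrausFamily.idTensor_apply_one_kronecker (D : KrausFamily m n) (σ : Matrix m m ℂ) :
    (D.idTensor R).apply ((1 : Matrix R R ℂ) ⊗ₖ σ) = (1 : Matrix R R ℂ) ⊗ₖ D.apply σ := by
  ext ⟨r, b⟩ ⟨s, b'⟩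
  rw [D.idTensor_apply, bipartiteBlock_one_kronecker, Matrix.kroneckerMap_apply]
  by_cases h : r = s
  · simp [h, Matrix.one_apply]
  · simp [h, KrausFamily.apply]

theorem KrausFamily.apply_posSemidef (D : KrausFamily m n) {ρ : Matrix m m ℂ}
    (hρ : ρ.PosSemidef) : (D.apply ρ).PosSemidef :=
  Matrix.posSemidef_sum _ fun _ _ => hρ.mul_mul_conjTranspose_same _

omit [Fintype m] [DecidableEq m] [DecidableEq R] in
theorem traceLeft_posSemidef {ρ : Matrix (R × m) (R × m) ℂ} (hρ : ρ.PosSemidef) :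
    (traceLeft ρ).PosSemidef :=
  Matrix.posSemidef_sum _ fun r _ => hρ.submatrix fun i => (r, i)

theorem IsDiagonalization.one_kronecker {σ W : Matrix m m ℂ} {q : m → ℝ}
    (h : IsDiagonalization σ W q) :
    IsDiagonalization ((1 : Matrix R R ℂ) ⊗ₖ σ) ((1 : Matrix R R ℂ) ⊗ₖ W) (fun x => q x.2) where
  mul_star := by
    rw [Matrix.conjTranspose_kronecker, ← Matrix.mul_kronecker_mul, h.mul_star,
      Matrix.conjTranspose_one, Matrix.mul_one, Matrix.one_kronecker_one]
  nonneg x := h.nonneg x.2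
  eq := by
    have : Matrix.diagonal (fun x : R × m => (q x.2 : ℂ))
        = (1 : Matrix R R ℂ) ⊗ₖ Matrix.diagonal (fun i => (q i : ℂ)) := by
      rw [← Matrix.diagonal_one, Matrix.diagonal_kronecker_diagonal]
      simp
    rw [this, Matrix.conjTranspose_kronecker, ← Matrix.mul_kronecker_mul,
      ← Matrix.mul_kronecker_mul, Matrix.conjTranspose_one, Matrix.mul_one, Matrix.mul_one, ← h.eq]

theorem IsDiagonalization.sum_overlap_eq {ρ U : Matrix m m ℂ} {p : m → ℝ}
    (h : IsDiagonalization ρ U p) (W : Matrix m m ℂ) (j : m) :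
    ∑ i, overlap U W j i * p i = ((Wᴴ * ρ * W) j j).re := by
  have : Wᴴ * ρ * W = (Wᴴ * U) * Matrix.diagonal (fun i => (p i : ℂ)) * (Wᴴ * U)ᴴ := by
    rw [h.eq]
    simp only [Matrix.conjTranspose_mul, Matrix.conjTranspose_conjTranspose, Matrix.mul_assoc]
  rw [this, Matrix.mul_apply, Complex.re_sum]
  refine Finset.sum_congr rfl fun i _ => ?_
  rw [Matrix.mul_diagonal, Matrix.conjTranspose_apply, mul_right_comm, RCLike.star_def,
    Complex.mul_conj, Complex.normSq_eq_norm_sq, ← Complex.ofReal_mul, Complex.ofReal_re, overlap]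

omit [DecidableEq m] in
theorem one_kronecker_conj_apply (ρ : Matrix (R × m) (R × m) ℂ) (W : Matrix m m ℂ) (r : R)
    (k : m) :
    (((1 : Matrix R R ℂ) ⊗ₖ W)ᴴ * ρ * ((1 : Matrix R R ℂ) ⊗ₖ W)) (r, k) (r, k)
      = (Wᴴ * bipartiteBlock ρ r r * W) k k := by
  simp only [Matrix.mul_apply, Matrix.conjTranspose_apply, Fintype.sum_prod_type,
    Matrix.kroneckerMap_apply, Matrix.one_apply, bipartiteBlock, Matrix.of_apply]
  rw [Finset.sum_eq_single r]
  · refine Finset.sum_congr rfl fun a' _ => ?_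
    rw [Finset.sum_eq_single r]
    · simp
    · intro r' _ h
      simp [h]
    · simp
  · intro s' _ h
    simp [h]
  · simp

theorem sum_overlap_one_kronecker {ρ U : Matrix (R × m) (R × m) ℂ} {p : R × m → ℝ}
    {W : Matrix m m ℂ} {q : m → ℝ}
    (hρ : IsDiagonalization ρ U p) (hσ : IsDiagonalization (traceLeft ρ) W q) (k : m) :
    ∑ r, ∑ i, overlap U ((1 : Matrix R R ℂ) ⊗ₖ W) (r, k) i * p i = q k := by
  simp only [hρ.sum_overlap_eq, one_kronecker_conj_apply]
  rw [← Complex.re_sum, ← Matrix.sum_apply, ← Finset.sum_mul, ← Finset.mul_sum,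
    show ∑ r, bipartiteBlock ρ r r = traceLeft ρ from rfl]
  have : Wᴴ * traceLeft ρ * W = Matrix.diagonal (fun i => (q i : ℂ)) := by
    have e : Wᴴ * (W * Matrix.diagonal (fun i => (q i : ℂ)) * Wᴴ) * W
        = (Wᴴ * W) * Matrix.diagonal (fun i => (q i : ℂ)) * (Wᴴ * W) := by
      simp only [Matrix.mul_assoc]
    rw [hσ.eq, e, hσ.star_mul, Matrix.one_mul, Matrix.mul_one]
  rw [this, Matrix.diagonal_apply_eq, Complex.ofReal_re]

theorem overlap_mul_eq_zero_of_traceLeft {ρ U : Matrix (R × m) (R × m) ℂ} {p : R × m → ℝ}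
    {W : Matrix m m ℂ} {q : m → ℝ}
    (hρ : IsDiagonalization ρ U p) (hσ : IsDiagonalization (traceLeft ρ) W q)
    (j i : R × m) (hj : q j.2 = 0) : overlap U ((1 : Matrix R R ℂ) ⊗ₖ W) j i * p i = 0 := by
  have h := sum_overlap_one_kronecker hρ hσ j.2
  have h0 : ∀ j i, 0 ≤ overlap U ((1 : Matrix R R ℂ) ⊗ₖ W) j i * p i := fun j i =>
    mul_nonneg (sq_nonneg _) (hρ.nonneg i)
  rw [hj, Finset.sum_eq_zero_iff_of_nonneg fun r _ => Finset.sum_nonneg fun i _ => h0 _ _] at h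
  have h2 := h j.1 (Finset.mem_univ _)
  rw [Finset.sum_eq_zero_iff_of_nonneg fun i _ => h0 _ _] at h2
  exact h2 i (Finset.mem_univ _)

theorem sum_overlap_log_one_kronecker {ρ U : Matrix (R × m) (R × m) ℂ} {p : R × m → ℝ}
    {W : Matrix m m ℂ} {q : m → ℝ}
    (hρ : IsDiagonalization ρ U p) (hσ : IsDiagonalization (traceLeft ρ) W q) :
    ∑ j : R × m, ∑ i, overlap U ((1 : Matrix R R ℂ) ⊗ₖ W) j i * p i * Real.log (q j.2)
      = ∑ k, q k * Real.log (q k) := by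
  simp only [← Finset.sum_mul]
  rw [Fintype.sum_prod_type_right]
  simp only [← Finset.sum_mul, sum_overlap_one_kronecker hρ hσ]

/-- A channel acting on the conditioning system cannot decrease the conditional entropy. -/
theorem KrausFamily.IsChannel.vnEntropy_sub_le {D : KrausFamily m n} (hD : D.IsChannel)
    {ρ : Matrix (R × m) (R × m) ℂ} (hρ : ρ.PosSemidef) :
    vnEntropy (D.apply (traceLeft ρ)) - vnEntropy ((D.idTensor R).apply ρ)
      ≤ vnEntropy (traceLeft ρ) - vnEntropy ρ := by
  obtain ⟨U, p, hU⟩ := hρ.exists_isDiagonalization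
  obtain ⟨W, q, hW⟩ := (traceLeft_posSemidef hρ).exists_isDiagonalization
  have hρ' := (D.idTensor R).apply_posSemidef hρ
  obtain ⟨U', p', hU'⟩ := hρ'.exists_isDiagonalization
  obtain ⟨W', q', hW'⟩ := (traceLeft_posSemidef hρ').exists_isDiagonalization
  have hW'' := hW'
  rw [traceLeft_idTensor_apply] at hW''
  have hsum : ∑ i, p' i = ∑ i, p i := by
    rw [hU.sum_eq_trace, hU'.sum_eq_trace, hD.idTensor.trace_apply]
  have h := (hD.idTensor (R := R)).relEntropy_le hU (hW.one_kronecker (R := R)) hU'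
    (by rw [D.idTensor_apply_one_kronecker]; exact hW''.one_kronecker)
    (fun j i hj => overlap_mul_eq_zero_of_traceLeft hU hW j i hj)
    (fun j i hj => overlap_mul_eq_zero_of_traceLeft hU' hW' j i hj) hsum
  rw [sum_overlap_log_one_kronecker hU hW, sum_overlap_log_one_kronecker hU' hW'] at h
  rw [hU.vnEntropy_eq, hW.vnEntropy_eq, hU'.vnEntropy_eq, hW''.vnEntropy_eq, ← sub_div, ← sub_div]
  refine div_le_div_of_nonneg_right ?_ (Real.log_nonneg one_le_two)
  linarith
end bipartite
end dpi

/-! ### Antidegradable channels -/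

/-- For a map `ψ` and a Kraus family, the amplitudes `(r, b, i) ↦ (Kᵢ ψ)_{b r}` arranged as a
matrix with rows `(r, b)` and columns `i`. -/
noncomputable def KrausFamily.outputAmplitude {R : Type} (N : KrausFamily A B) (ψ : Matrix A R ℂ) :
    Matrix (R × B) N.ι ℂ :=
  Matrix.of fun x i => (N.K i * ψ) x.2 x.1

/-- The amplitudes `(r, b, i) ↦ (Kᵢ ψ)_{b r}` with rows `(r, i)` and columns `b`. -/
noncomputable def KrausFamily.envAmplitude {R : Type} (N : KrausFamily A B) (ψ : Matrix A R ℂ) :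
    Matrix (R × N.ι) B ℂ :=
  Matrix.of fun x b => (N.K x.2 * ψ) b x.1

theorem mul_conjTranspose_apply {X Y R : Type} [Fintype R] (M : Matrix X R ℂ) (M' : Matrix Y R ℂ)
    (x : X) (y : Y) : (M * M'ᴴ) x y = ∑ r, M x r * starRingEnd ℂ (M' y r) := rfl

theorem KrausFamily.compl_mul_conjTranspose_apply {R : Type} [Fintype R] (N : KrausFamily A B)
    (ψ χ : Matrix A R ℂ) (i j : N.ι) :
    N.compl (ψ * χᴴ) i j = ∑ b, ∑ r, (N.K i * ψ) b r * starRingEnd ℂ ((N.K j * χ) b r) := by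
  have : N.K i * (ψ * χᴴ) * (N.K j)ᴴ = (N.K i * ψ) * (N.K j * χ)ᴴ := by
    simp only [Matrix.conjTranspose_mul, Matrix.mul_assoc]
  rw [KrausFamily.compl, Matrix.of_apply, this, Matrix.trace]
  simp only [Matrix.diag_apply, mul_conjTranspose_apply]

theorem KrausFamily.apply_mul_conjTranspose_apply {R : Type} [Fintype R] (N : KrausFamily A B)
    (ψ χ : Matrix A R ℂ) (b b' : B) :
    N.apply (ψ * χᴴ) b b' = ∑ i, ∑ r, (N.K i * ψ) b r * starRingEnd ℂ ((N.K i * χ) b' r) := by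
  have : ∀ i, N.K i * (ψ * χᴴ) * (N.K i)ᴴ = (N.K i * ψ) * (N.K i * χ)ᴴ := fun i => by
    simp only [Matrix.conjTranspose_mul, Matrix.mul_assoc]
  simp only [KrausFamily.apply, this, Matrix.sum_apply, mul_conjTranspose_apply]

section purification
variable {R : Type} [Fintype R] [DecidableEq R]

theorem KrausFamily.vnEntropy_output (N : KrausFamily A B) (ψ : Matrix A R ℂ) :
    vnEntropy (N.outputAmplitude ψ * (N.outputAmplitude ψ)ᴴ) = vnEntropy (N.compl (ψ * ψᴴ)) := by
  rw [vnEntropy_mul_conjTranspose,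
    ← vnEntropy_transpose (Matrix.isHermitian_conjTranspose_mul_self _)]
  congr 1
  ext i j
  rw [N.compl_mul_conjTranspose_apply, Matrix.transpose_apply, Matrix.mul_apply,
    Fintype.sum_prod_type_right]
  simp only [Matrix.conjTranspose_apply, KrausFamily.outputAmplitude, Matrix.of_apply,
    RCLike.star_def, mul_comm]

theorem KrausFamily.vnEntropy_env (N : KrausFamily A B) (ψ : Matrix A R ℂ) :
    vnEntropy (N.envAmplitude ψ * (N.envAmplitude ψ)ᴴ) = vnEntropy (N.apply (ψ * ψᴴ)) := by
  rw [vnEntropy_mul_conjTranspose,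
    ← vnEntropy_transpose (Matrix.isHermitian_conjTranspose_mul_self _)]
  congr 1
  ext i j
  rw [N.apply_mul_conjTranspose_apply, Matrix.transpose_apply, Matrix.mul_apply,
    Fintype.sum_prod_type_right]
  simp only [Matrix.conjTranspose_apply, KrausFamily.envAmplitude, Matrix.of_apply,
    RCLike.star_def, mul_comm]

omit [Fintype R] [DecidableEq R] in
theorem KrausFamily.mul_col_apply (N : KrausFamily A B) (ψ : Matrix A R ℂ) (i : N.ι) (b : B)
    (r : R) (u : Unit) :
    (N.K i * ψ.submatrix id (fun _ : Unit => r)) b u = (N.K i * ψ) b r := by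
  simp [Matrix.mul_apply]

omit [Fintype R] [DecidableEq R] in
theorem KrausFamily.bipartiteBlock_env (N : KrausFamily A B) (ψ : Matrix A R ℂ) (r s : R) :
    bipartiteBlock (N.envAmplitude ψ * (N.envAmplitude ψ)ᴴ) r s =
      N.compl (ψ.submatrix id (fun _ : Unit => r) * (ψ.submatrix id (fun _ : Unit => s))ᴴ) := by
  ext i j
  rw [N.compl_mul_conjTranspose_apply]
  simp only [bipartiteBlock, Matrix.of_apply, mul_conjTranspose_apply,
    N.mul_col_apply, KrausFamily.envAmplitude, Finset.univ_unique, Finset.sum_singleton]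

omit [Fintype R] [DecidableEq R] in
theorem KrausFamily.bipartiteBlock_output (N : KrausFamily A B) (ψ : Matrix A R ℂ) (r s : R) :
    bipartiteBlock (N.outputAmplitude ψ * (N.outputAmplitude ψ)ᴴ) r s =
      N.apply (ψ.submatrix id (fun _ : Unit => r) * (ψ.submatrix id (fun _ : Unit => s))ᴴ) := by
  ext i j
  rw [N.apply_mul_conjTranspose_apply]
  simp only [bipartiteBlock, Matrix.of_apply, mul_conjTranspose_apply,
    N.mul_col_apply, KrausFamily.outputAmplitude, Finset.univ_unique, Finset.sum_singleton]

omit [DecidableEq R] in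
theorem KrausFamily.traceLeft_env (N : KrausFamily A B) (ψ : Matrix A R ℂ) :
    traceLeft (N.envAmplitude ψ * (N.envAmplitude ψ)ᴴ) = N.compl (ψ * ψᴴ) := by
  ext i j
  rw [N.compl_mul_conjTranspose_apply, Finset.sum_comm]
  simp only [traceLeft, Matrix.sum_apply, bipartiteBlock, Matrix.of_apply,
    mul_conjTranspose_apply, KrausFamily.envAmplitude]
end purification

theorem KrausFamily.IsAntidegradable.cohInfo_nonpos {N : KrausFamily A B}
    (hN : N.IsAntidegradable) {φ : Matrix A A ℂ} (hφ : φ.PosSemidef) : cohInfo N φ ≤ 0 := by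
  obtain ⟨D, hD, hDN⟩ := hN
  obtain ⟨ψ, rfl⟩ : ∃ ψ : Matrix A A ℂ, φ = ψ * ψᴴ := by
    obtain ⟨U, p, h⟩ := hφ.exists_isDiagonalization
    refine ⟨U * Matrix.diagonal fun i => ((Real.sqrt (p i) : ℝ) : ℂ), ?_⟩
    rw [Matrix.conjTranspose_mul, Matrix.diagonal_conjTranspose, h.eq]
    have : ∀ i, (p i : ℂ) = (Real.sqrt (p i) : ℂ) * (Real.sqrt (p i) : ℂ) := fun i => by
      rw [← Complex.ofReal_mul, Real.mul_self_sqrt (h.nonneg i)]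
    have hd : Matrix.diagonal (fun i => (p i : ℂ)) =
        Matrix.diagonal (fun i => (Real.sqrt (p i) : ℂ)) *
          Matrix.diagonal (star fun i => (Real.sqrt (p i) : ℂ)) := by
      rw [Matrix.diagonal_mul_diagonal]
      congr 1
      funext i
      simpa using this i
    rw [hd]
    simp only [Matrix.mul_assoc]
  have h := hD.vnEntropy_sub_le (R := A)
    (Matrix.posSemidef_self_mul_conjTranspose (N.envAmplitude ψ))
  have hout : (D.idTensor A).apply (N.envAmplitude ψ * (N.envAmplitude ψ)ᴴ)
      = N.outputAmplitude ψ * (N.outputAmplitude ψ)ᴴ := by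
    ext ⟨r, b⟩ ⟨s, b'⟩
    rw [D.idTensor_apply, N.bipartiteBlock_env, hDN, ← N.bipartiteBlock_output]
    rfl
  rw [hout, N.traceLeft_env, hDN, N.vnEntropy_output, N.vnEntropy_env] at h
  rw [cohInfo]
  linarith

theorem KrausFamily.cohInfo_pure (N : KrausFamily A B) (v : Matrix A Unit ℂ) :
    cohInfo N (v * vᴴ) = 0 := by
  have h : vnEntropy (N.apply (v * vᴴ)) = vnEntropy (N.compl (v * vᴴ)) := by
    set M : Matrix B N.ι ℂ := Matrix.of fun b i => (N.K i * v) b () with hM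
    have h1 : N.apply (v * vᴴ) = M * Mᴴ := by
      ext b b'
      rw [N.apply_mul_conjTranspose_apply, Matrix.mul_apply]
      simp [hM]
    have h2 : N.compl (v * vᴴ) = (Mᴴ * M)ᵀ := by
      ext i j
      rw [N.compl_mul_conjTranspose_apply, Matrix.transpose_apply, Matrix.mul_apply]
      simp [hM, mul_comm]
    rw [h1, h2, vnEntropy_transpose (Matrix.isHermitian_conjTranspose_mul_self _),
      vnEntropy_mul_conjTranspose]
  rw [cohInfo, h, sub_self]

theorem KrausFamily.IsAntidegradable.Q1_eq_zero {N : KrausFamily A B}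
    (hN : N.IsAntidegradable) : Q1 N = 0 := by
  rcases isEmpty_or_nonempty A with hA | ⟨⟨a⟩⟩
  · have : {x | ∃ φ : Matrix A A ℂ, IsDensity φ ∧ x = cohInfo N φ} = ∅ := by
      refine Set.eq_empty_iff_forall_notMem.2 ?_
      rintro x ⟨φ, hφ, -⟩
      simpa [Matrix.trace] using hφ.2
    rw [Q1, this, Real.sSup_empty]
  · refine IsGreatest.csSup_eq ⟨?_, ?_⟩
    · refine ⟨_, ⟨Matrix.posSemidef_self_mul_conjTranspose
        (Matrix.of fun (x : A) (_ : Unit) => if x = a then (1 : ℂ) else 0), ?_⟩,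
        (N.cohInfo_pure _).symm⟩
      simp [Matrix.trace, Matrix.mul_apply]
    · rintro x ⟨φ, hφ, rfl⟩
      exact hN.cohInfo_nonpos hφ.1

/-! ### Tensor powers -/

theorem sum_prod_pi {κ : Type} [Fintype κ] {n : ℕ} (g : Fin n → κ → ℂ) :
    ∑ f : Fin n → κ, ∏ i, g i (f i) = ∏ i, ∑ k, g i k :=
  (Fintype.prod_sum g).symm

theorem KrausFamily.IsChannel.pow {D : KrausFamily A B} (hD : D.IsChannel) (n : ℕ) :
    (D.pow n).IsChannel := by
  ext a a'
  have h1 : ∀ x y : A, ∑ k, ∑ b, starRingEnd ℂ (D.K k b x) * D.K k b y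
      = (1 : Matrix A A ℂ) x y := by
    intro x y
    rw [← show ∑ i, (D.K i)ᴴ * D.K i = 1 from hD]
    simp only [Matrix.sum_apply, Matrix.mul_apply, Matrix.conjTranspose_apply, RCLike.star_def]
  simp only [Matrix.sum_apply, Matrix.mul_apply, Matrix.conjTranspose_apply, RCLike.star_def]
  change ∑ f : Fin n → D.ι, ∑ b : Fin n → B,
    starRingEnd ℂ (∏ i, D.K (f i) (b i) (a i)) * ∏ i, D.K (f i) (b i) (a' i) = _
  simp only [map_prod, ← Finset.prod_mul_distrib]
  have h2 : ∀ f : Fin n → D.ι, ∑ b : Fin n → B,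
      ∏ i, starRingEnd ℂ (D.K (f i) (b i) (a i)) * D.K (f i) (b i) (a' i)
      = ∏ i, ∑ b, starRingEnd ℂ (D.K (f i) b (a i)) * D.K (f i) b (a' i) := fun f =>
    sum_prod_pi fun i b => starRingEnd ℂ (D.K (f i) b (a i)) * D.K (f i) b (a' i)
  simp only [h2]
  rw [sum_prod_pi fun i k => ∑ b, starRingEnd ℂ (D.K k b (a i)) * D.K k b (a' i)]
  simp only [h1, Matrix.one_apply]
  by_cases h : a = a'
  · simp [h]
  · obtain ⟨i, hi⟩ := Function.ne_iff.1 h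
    rw [if_neg h]
    exact Finset.prod_eq_zero (Finset.mem_univ i) (if_neg hi)

/-- The matrix elements of a channel. -/
noncomputable def KrausFamily.applyKernel (N : KrausFamily A B) (b b' : B) (a a' : A) : ℂ :=
  ∑ k, N.K k b a * starRingEnd ℂ (N.K k b' a')

/-- The matrix elements of a complementary channel. -/
noncomputable def KrausFamily.complKernel (N : KrausFamily A B) (i j : N.ι) (a a' : A) : ℂ :=
  ∑ b, N.K i b a * starRingEnd ℂ (N.K j b a')

theorem KrausFamily.apply_eq_kernel (N : KrausFamily A B) (ρ : Matrix A A ℂ) (b b' : B) :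
    N.apply ρ b b' = ∑ a, ∑ a', N.applyKernel b b' a a' * ρ a a' := by
  simp only [N.apply_apply, KrausFamily.applyKernel, Finset.sum_mul]
  rw [Finset.sum_comm, Finset.sum_congr rfl fun _ _ => Finset.sum_comm, Finset.sum_comm]
  refine Finset.sum_congr rfl fun _ _ => Finset.sum_congr rfl fun _ _ =>
    Finset.sum_congr rfl fun _ _ => by ring

theorem KrausFamily.compl_eq_kernel (N : KrausFamily A B) (ρ : Matrix A A ℂ) (i j : N.ι) :
    N.compl ρ i j = ∑ a, ∑ a', N.complKernel i j a a' * ρ a a' := by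
  simp only [KrausFamily.compl, Matrix.of_apply, Matrix.trace, Matrix.diag_apply,
    Matrix.mul_apply, KrausFamily.complKernel, Finset.sum_mul, Matrix.conjTranspose_apply,
    RCLike.star_def]
  rw [Finset.sum_comm, Finset.sum_congr rfl fun _ _ => Finset.sum_comm, Finset.sum_comm]
  refine Finset.sum_congr rfl fun _ _ => Finset.sum_congr rfl fun _ _ =>
    Finset.sum_congr rfl fun _ _ => by ring

theorem KrausFamily.applyKernel_pow (N : KrausFamily A B) (n : ℕ) (b b' : Fin n → B)
    (a a' : Fin n → A) :
    (N.pow n).applyKernel b b' a a' = ∏ i, N.applyKernel (b i) (b' i) (a i) (a' i) := by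
  change ∑ f : Fin n → N.ι,
    (∏ i, N.K (f i) (b i) (a i)) * starRingEnd ℂ (∏ i, N.K (f i) (b' i) (a' i)) = _
  simp only [map_prod, ← Finset.prod_mul_distrib]
  exact sum_prod_pi fun i k => N.K k (b i) (a i) * starRingEnd ℂ (N.K k (b' i) (a' i))

theorem KrausFamily.complKernel_pow (N : KrausFamily A B) (n : ℕ) (f g : Fin n → N.ι)
    (a a' : Fin n → A) :
    (N.pow n).complKernel f g a a' = ∏ i, N.complKernel (f i) (g i) (a i) (a' i) := by
  change ∑ b : Fin n → B,
    (∏ i, N.K (f i) (b i) (a i)) * starRingEnd ℂ (∏ i, N.K (g i) (b i) (a' i)) = _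
  simp only [map_prod, ← Finset.prod_mul_distrib]
  exact sum_prod_pi fun i b => N.K (f i) b (a i) * starRingEnd ℂ (N.K (g i) b (a' i))

theorem KrausFamily.apply_compl_eq_apply_iff (N : KrausFamily A B) (D : KrausFamily N.ι B) :
    (∀ ρ, D.apply (N.compl ρ) = N.apply ρ) ↔ ∀ b b' a a',
      ∑ i, ∑ j, D.applyKernel b b' i j * N.complKernel i j a a' = N.applyKernel b b' a a' := by
  have hL : ∀ ρ b b', D.apply (N.compl ρ) b b' = ∑ a, ∑ a',
      (∑ i, ∑ j, D.applyKernel b b' i j * N.complKernel i j a a') * ρ a a' := by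
    intro ρ b b'
    simp only [D.apply_eq_kernel, N.compl_eq_kernel, Finset.mul_sum, Finset.sum_mul, mul_assoc]
    calc _ = ∑ i, ∑ a, ∑ j, ∑ a',
        D.applyKernel b b' i j * (N.complKernel i j a a' * ρ a a') :=
          Finset.sum_congr rfl fun _ _ => Finset.sum_comm
      _ = ∑ a, ∑ i, ∑ j, ∑ a',
        D.applyKernel b b' i j * (N.complKernel i j a a' * ρ a a') := Finset.sum_comm
      _ = ∑ a, ∑ i, ∑ a', ∑ j,
        D.applyKernel b b' i j * (N.complKernel i j a a' * ρ a a') :=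
          Finset.sum_congr rfl fun _ _ => Finset.sum_congr rfl fun _ _ => Finset.sum_comm
      _ = _ := Finset.sum_congr rfl fun _ _ => Finset.sum_comm
  constructor
  · intro h b b' a a'
    have h1 := congrFun (congrFun (h (Matrix.single a a' 1)) b) b'
    rw [hL, N.apply_eq_kernel] at h1
    simpa [Matrix.single_apply, ite_and] using h1
  · intro h ρ
    ext b b'
    rw [hL, N.apply_eq_kernel]
    simp only [h]

theorem KrausFamily.IsAntidegradable.pow {N : KrausFamily A B} (hN : N.IsAntidegradable)
    (n : ℕ) : (N.pow n).IsAntidegradable := by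
  obtain ⟨D, hD, hDN⟩ := hN
  refine ⟨D.pow n, hD.pow n, ((N.pow n).apply_compl_eq_apply_iff (D.pow n)).2 ?_⟩
  intro b b' a a'
  have h := (N.apply_compl_eq_apply_iff D).1 hDN
  rw [N.applyKernel_pow]
  change ∑ f : Fin n → N.ι, ∑ g : Fin n → N.ι,
    (D.pow n).applyKernel b b' f g * (N.pow n).complKernel f g a a' = _
  simp only [D.applyKernel_pow, N.complKernel_pow, ← Finset.prod_mul_distrib, ← h]
  have h2 : ∀ f : Fin n → N.ι, ∑ g : Fin n → N.ι, ∏ i,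
      D.applyKernel (b i) (b' i) (f i) (g i) * N.complKernel (f i) (g i) (a i) (a' i)
      = ∏ i, ∑ j, D.applyKernel (b i) (b' i) (f i) j * N.complKernel (f i) j (a i) (a' i) :=
    fun f => sum_prod_pi fun i j =>
      D.applyKernel (b i) (b' i) (f i) j * N.complKernel (f i) j (a i) (a' i)
  simp only [h2]
  exact sum_prod_pi fun i k =>
    ∑ j, D.applyKernel (b i) (b' i) k j * N.complKernel k j (a i) (a' i)

/-- An antidegradable quantum channel has zero quantum capacity. -/
theorem quantum_capacity_eq_zero_of_antidegradable
    {A B : Type} [Fintype A] [DecidableEq A] [Fintype B] [DecidableEq B]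
    (N : KrausFamily A B) (hN : N.IsChannel) (hanti : N.IsAntidegradable) :
    Qcap N = 0 := by
  have : {x | ∃ n : ℕ, 0 < n ∧ x = (1 / (n : ℝ)) * Q1 (N.pow n)} = {0} := by
    ext x
    simp only [(hanti.pow _).Q1_eq_zero, mul_zero, Set.mem_ofPred_eq, Set.mem_singleton_iff]
    exact ⟨fun ⟨_, _, h⟩ => h, fun h => ⟨1, one_pos, h⟩⟩
  rw [Qcap, this, csSup_singleton]
end

section
/- Let N be a degradable quantum channel. Then the coherent information I^c(N,φ) is a concave function of the input density matrix φ: for all density matrices φ_0, φ_1 and all 0 ≤ p ≤ 1, p·I^c(N,φ_0) + (1−p)·I^c(N,φ_1) ≤ I^c(N, p·φ_0 + (1−p)·φ_1). -/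
open scoped Matrix Kronecker ComplexOrder

variable {A B : Type} [Fintype A] [DecidableEq A] [Fintype B] [DecidableEq B]

open Finset Filter Topology in
/-- If a weighted sum of resolvents is dominated by another one of the same total weight, then
the corresponding weighted sums of logarithms are ordered the opposite way. -/
lemma sum_mul_log_le_of_sum_div_le {κ κ' : Type*} [Fintype κ] [Fintype κ']
    {a b : κ → ℝ} {a' b' : κ' → ℝ}
    (hb : ∀ k, 0 ≤ b k) (hb' : ∀ k, 0 ≤ b' k)
    (hab : ∀ k, b k = 0 → a k = 0) (hab' : ∀ k, b' k = 0 → a' k = 0)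
    (hsum : ∑ k, a k = ∑ k, a' k)
    (hle : ∀ t : ℝ, 0 < t → ∑ k, a k / (b k + t) ≤ ∑ k, a' k / (b' k + t)) :
    ∑ k, a' k * Real.log (b' k) ≤ ∑ k, a k * Real.log (b k) := by
  have cont : ∀ {x y : ℝ}, 0 ≤ y → (y = 0 → x = 0) →
      ContinuousOn (fun t => x * Real.log (y + t)) (Set.Ici 0) := by
    intro x y hy hxy
    rcases hy.eq_or_lt with h | h
    · simp only [hxy h.symm, zero_mul]
      exact continuousOn_const
    · refine continuousOn_const.mul (ContinuousOn.log (by fun_prop) fun t ht => ?_)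
      have : (0 : ℝ) ≤ t := ht
      positivity
  have hderiv : ∀ {x y t : ℝ}, 0 ≤ y → 0 < t →
      HasDerivAt (fun t => x * Real.log (y + t)) (x / (y + t)) t := by
    intro x y t hy ht
    have h1 : HasDerivAt (fun t => y + t) 1 t := (hasDerivAt_id t).const_add y
    have h2 := (h1.log (by positivity)).const_mul x
    simpa [div_eq_mul_inv] using h2
  have lim : ∀ {x y : ℝ}, 0 ≤ y →
      Tendsto (fun t => x * Real.log (y + t) - x * Real.log t) atTop (𝓝 0) := by
    intro x y hy
    have h1 : Tendsto (fun t : ℝ => y / t + 1) atTop (𝓝 (0 + 1)) :=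
      (tendsto_const_nhds.div_atTop tendsto_id).add_const 1
    have h2 := (h1.log (by norm_num)).const_mul x
    simp only [zero_add, Real.log_one, mul_zero] at h2
    refine h2.congr' ?_
    filter_upwards [eventually_gt_atTop 0] with t ht
    rw [← mul_sub, ← Real.log_div (by positivity) ht.ne', add_div, div_self ht.ne']
  let F : ℝ → ℝ := fun t =>
    ∑ k, a k * Real.log (b k + t) - ∑ k, a' k * Real.log (b' k + t)
  have hF : AntitoneOn F (Set.Ici 0) := by
    have hd : ∀ t : ℝ, 0 < t →
        HasDerivAt F (∑ k, a k / (b k + t) - ∑ k, a' k / (b' k + t)) t := fun t ht =>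
      (HasDerivAt.fun_sum fun k _ => hderiv (hb k) ht).sub
        (HasDerivAt.fun_sum fun k _ => hderiv (hb' k) ht)
    refine antitoneOn_of_deriv_nonpos (convex_Ici 0) ?_ ?_ ?_
    · exact (continuousOn_finsetSum _ fun k _ => cont (hb k) (hab k)).sub
        (continuousOn_finsetSum _ fun k _ => cont (hb' k) (hab' k))
    · intro t ht
      rw [interior_Ici] at ht
      exact (hd t ht).differentiableAt.differentiableWithinAt
    · intro t ht
      rw [interior_Ici] at ht
      rw [(hd t ht).deriv]
      exact sub_nonpos.2 (hle t ht)
  have hlim : Tendsto F atTop (𝓝 0) := by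
    have h1 := (tendsto_finsetSum univ fun k _ => lim (x := a k) (hb k)).sub
      (tendsto_finsetSum univ fun k _ => lim (x := a' k) (hb' k))
    simp only [sum_const_zero, sub_zero] at h1
    refine h1.congr fun t => ?_
    simp only [F, sum_sub_distrib, ← sum_mul, hsum]
    ring
  have h0 : 0 ≤ F 0 := by
    refine le_of_tendsto hlim ?_
    filter_upwards [eventually_ge_atTop 0] with t ht
    exact hF (Set.mem_Ici.2 le_rfl) ht ht
  simpa [F] using h0

namespace Matrix

/-- The concave quadratic form whose supremum over `X` is the quadratic form at `ρ` of the
inverse of `X ↦ σ X + t X ρ`. -/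
noncomputable def resolventForm {n : Type*} [Fintype n] (t : ℝ) (ρ σ X : Matrix n n ℂ) : ℝ :=
  2 * (Xᴴ * ρ).trace.re - (σ * (X * Xᴴ)).trace.re - t * (ρ * (Xᴴ * X)).trace.re

lemma trace_diagonal_mul_mul_conjTranspose_re {m n : Type*} [Fintype m] [DecidableEq m]
    [Fintype n] (q : m → ℝ) (Y : Matrix m n ℂ) :
    (diagonal (fun j => (q j : ℂ)) * (Y * Yᴴ)).trace.re =
      ∑ j, ∑ i, q j * Complex.normSq (Y j i) := by
  simp only [trace, diag_apply, diagonal_mul, mul_apply (M := Y), conjTranspose_apply,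
    Complex.star_def, Complex.mul_conj, ← Complex.ofReal_sum, ← Complex.ofReal_mul,
    Complex.ofReal_re, Finset.mul_sum]

lemma trace_diagonal_mul_conjTranspose_mul_re {m n : Type*} [Fintype m] [Fintype n]
    [DecidableEq n] (p : n → ℝ) (Y : Matrix m n ℂ) :
    (diagonal (fun i => (p i : ℂ)) * (Yᴴ * Y)).trace.re =
      ∑ j, ∑ i, p i * Complex.normSq (Y j i) := by
  rw [Finset.sum_comm]
  simp only [trace, diag_apply, diagonal_mul, mul_apply (M := Yᴴ), conjTranspose_apply,
    Complex.star_def, ← Complex.normSq_eq_conj_mul_self, ← Complex.ofReal_sum,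
    ← Complex.ofReal_mul, Complex.ofReal_re, Finset.mul_sum]

variable {n : Type*} [Fintype n] [DecidableEq n]

lemma resolventForm_spectral {U V : Matrix n n ℂ} (hU : Uᴴ * U = 1) (hV : Vᴴ * V = 1)
    (p q : n → ℝ) (t : ℝ) (Y : Matrix n n ℂ) :
    resolventForm t (U * diagonal (fun i => (p i : ℂ)) * Uᴴ)
        (V * diagonal (fun i => (q i : ℂ)) * Vᴴ) (V * Y * Uᴴ) =
      ∑ j, ∑ i, (2 * p i * (star (Y j i) * (Vᴴ * U) j i).re
        - (q j + t * p i) * Complex.normSq (Y j i)) := by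
  have cU : ∀ Z : Matrix n n ℂ, Uᴴ * (U * Z) = Z := fun Z => by rw [← mul_assoc, hU, one_mul]
  have cV : ∀ Z : Matrix n n ℂ, Vᴴ * (V * Z) = Z := fun Z => by rw [← mul_assoc, hV, one_mul]
  have h1 : ((V * Y * Uᴴ)ᴴ * (U * diagonal (fun i => (p i : ℂ)) * Uᴴ)).trace.re =
      ∑ j, ∑ i, p i * (star (Y j i) * (Vᴴ * U) j i).re := by
    have : (V * Y * Uᴴ)ᴴ * (U * diagonal (fun i => (p i : ℂ)) * Uᴴ) =
        U * (Yᴴ * ((Vᴴ * U) * diagonal (fun i => (p i : ℂ))) * Uᴴ) := by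
      simp only [conjTranspose_mul, conjTranspose_conjTranspose, mul_assoc]
    rw [this, trace_mul_comm, mul_assoc, hU, mul_one, Finset.sum_comm]
    simp only [trace, diag_apply, mul_apply (M := Yᴴ), mul_diagonal, conjTranspose_apply,
      Complex.re_sum]
    refine Finset.sum_congr rfl fun i _ => Finset.sum_congr rfl fun j _ => ?_
    rw [← mul_assoc, mul_comm _ (p i : ℂ), Complex.re_ofReal_mul]
  have h2 : ((V * diagonal (fun i => (q i : ℂ)) * Vᴴ) * ((V * Y * Uᴴ) * (V * Y * Uᴴ)ᴴ)).trace =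
      (diagonal (fun i => (q i : ℂ)) * (Y * Yᴴ)).trace := by
    have : (V * diagonal (fun i => (q i : ℂ)) * Vᴴ) * ((V * Y * Uᴴ) * (V * Y * Uᴴ)ᴴ) =
        V * (diagonal (fun i => (q i : ℂ)) * (Y * Yᴴ) * Vᴴ) := by
      simp only [conjTranspose_mul, conjTranspose_conjTranspose, mul_assoc, cU, cV]
    rw [this, trace_mul_comm, mul_assoc, hV, mul_one]
  have h3 : ((U * diagonal (fun i => (p i : ℂ)) * Uᴴ) * ((V * Y * Uᴴ)ᴴ * (V * Y * Uᴴ))).trace =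
      (diagonal (fun i => (p i : ℂ)) * (Yᴴ * Y)).trace := by
    have : (U * diagonal (fun i => (p i : ℂ)) * Uᴴ) * ((V * Y * Uᴴ)ᴴ * (V * Y * Uᴴ)) =
        U * (diagonal (fun i => (p i : ℂ)) * (Yᴴ * Y) * Uᴴ) := by
      simp only [conjTranspose_mul, conjTranspose_conjTranspose, mul_assoc, cU, cV]
    rw [this, trace_mul_comm, mul_assoc, hU, mul_one]
  rw [resolventForm, h1, h2, h3, trace_diagonal_mul_mul_conjTranspose_re,
    trace_diagonal_mul_conjTranspose_mul_re]
  simp only [Finset.mul_sum, ← Finset.sum_sub_distrib]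
  refine Finset.sum_congr rfl fun j _ => Finset.sum_congr rfl fun i _ => ?_
  ring

lemma two_mul_re_sub_le {p q t : ℝ} (hp : 0 ≤ p) (hq : 0 ≤ q) (ht : 0 < t) (y w : ℂ) :
    2 * p * (star y * w).re - (q + t * p) * Complex.normSq y ≤
      Complex.normSq w * p / (q / p + t) := by
  rcases hp.eq_or_lt with rfl | hp
  · simpa using mul_nonneg hq (Complex.normSq_nonneg y)
  · have hd : 0 < q + t * p := by positivity
    have e : Complex.normSq w * p / (q / p + t) = Complex.normSq w * p ^ 2 / (q + t * p) := by
      field_simp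
    rw [e, le_div_iff₀ hd]
    have := Complex.normSq_nonneg ((q + t * p : ℝ) * y - p * w)
    simp only [Complex.normSq_apply, Complex.sub_re, Complex.sub_im, Complex.ofReal_re,
      Complex.ofReal_im, Complex.star_def, Complex.mul_re, Complex.mul_im, Complex.conj_re,
      Complex.conj_im] at this ⊢
    nlinarith

lemma two_mul_re_sub_eq {p q t : ℝ} (hp : 0 ≤ p) (hq : 0 ≤ q) (ht : 0 < t) (w : ℂ) :
    2 * p * (star ((p / (q + t * p) : ℝ) * w) * w).re
        - (q + t * p) * Complex.normSq ((p / (q + t * p) : ℝ) * w) =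
      Complex.normSq w * p / (q / p + t) := by
  rcases hp.eq_or_lt with rfl | hp
  · simp
  · have hd : 0 < q + t * p := by positivity
    have e : Complex.normSq w * p / (q / p + t) = Complex.normSq w * p ^ 2 / (q + t * p) := by
      field_simp
    rw [e]
    simp only [Complex.normSq_apply, Complex.ofReal_re, Complex.ofReal_im, Complex.star_def,
      Complex.mul_re, Complex.mul_im, Complex.conj_re, Complex.conj_im]
    field_simp
    ring

lemma resolventForm_le {U V : Matrix n n ℂ} (hU : Uᴴ * U = 1) (hV : Vᴴ * V = 1)
    {p q : n → ℝ} (hp : ∀ i, 0 ≤ p i) (hq : ∀ i, 0 ≤ q i) {t : ℝ} (ht : 0 < t)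
    (X : Matrix n n ℂ) :
    resolventForm t (U * diagonal (fun i => (p i : ℂ)) * Uᴴ)
        (V * diagonal (fun i => (q i : ℂ)) * Vᴴ) X ≤
      ∑ j, ∑ i, Complex.normSq ((Vᴴ * U) j i) * p i / (q j / p i + t) := by
  have hX : X = V * (Vᴴ * X * U) * Uᴴ := by
    rw [mul_eq_one_comm] at hU hV
    rw [mul_assoc V, mul_assoc (Vᴴ * X), hU, mul_one, ← mul_assoc, hV, one_mul]
  rw [hX, resolventForm_spectral hU hV]
  exact Finset.sum_le_sum fun j _ => Finset.sum_le_sum fun i _ =>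
    two_mul_re_sub_le (hp i) (hq j) ht _ _

lemma exists_resolventForm_eq {U V : Matrix n n ℂ} (hU : Uᴴ * U = 1) (hV : Vᴴ * V = 1)
    {p q : n → ℝ} (hp : ∀ i, 0 ≤ p i) (hq : ∀ i, 0 ≤ q i) {t : ℝ} (ht : 0 < t) :
    ∃ X, resolventForm t (U * diagonal (fun i => (p i : ℂ)) * Uᴴ)
        (V * diagonal (fun i => (q i : ℂ)) * Vᴴ) X =
      ∑ j, ∑ i, Complex.normSq ((Vᴴ * U) j i) * p i / (q j / p i + t) := by
  refine ⟨V * (of fun j i => ((p i / (q j + t * p i) : ℝ) : ℂ) * (Vᴴ * U) j i) * Uᴴ, ?_⟩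
  rw [resolventForm_spectral hU hV]
  exact Finset.sum_congr rfl fun j _ => Finset.sum_congr rfl fun i _ =>
    two_mul_re_sub_eq (hp i) (hq j) ht _

lemma PosSemidef.trace_mul_conjTranspose_mul_self_re_nonneg {m n : Type*} [Fintype m]
    [Fintype n] {σ : Matrix n n ℂ}
    (hσ : σ.PosSemidef) (Z : Matrix m n ℂ) : 0 ≤ (σ * (Zᴴ * Z)).trace.re := by
  rw [← Matrix.mul_assoc, trace_mul_comm, ← Matrix.mul_assoc]
  exact (Complex.le_def.1 (hσ.mul_mul_conjTranspose_same Z).trace_nonneg).1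

end Matrix

namespace KrausFamily

open Matrix

/-- The adjoint (Heisenberg picture) of a Kraus family. -/
noncomputable def adj (N : KrausFamily A B) (X : Matrix B B ℂ) : Matrix A A ℂ :=
  ∑ i, (N.K i)ᴴ * X * N.K i

lemma adj_conjTranspose (N : KrausFamily A B) (X : Matrix B B ℂ) :
    N.adj Xᴴ = (N.adj X)ᴴ := by
  simp [adj, conjTranspose_sum, Matrix.mul_assoc]

lemma trace_apply_mul (N : KrausFamily A B) (ρ : Matrix A A ℂ) (X : Matrix B B ℂ) :
    (N.apply ρ * X).trace = (ρ * N.adj X).trace := by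
  simp only [apply, adj, Finset.sum_mul, Finset.mul_sum, trace_sum]
  refine Finset.sum_congr rfl fun i _ => ?_
  rw [Matrix.mul_assoc, Matrix.mul_assoc, trace_mul_comm]
  simp only [Matrix.mul_assoc]

lemma IsChannel.trace_apply_s7 {N : KrausFamily A B} (hN : N.IsChannel) (ρ : Matrix A A ℂ) :
    (N.apply ρ).trace = ρ.trace := by
  have h1 : N.adj 1 = 1 := by simpa [adj, IsChannel] using hN
  simpa [h1] using N.trace_apply_mul ρ 1

lemma apply_posSemidef_s7 (N : KrausFamily A B) {ρ : Matrix A A ℂ} (hρ : ρ.PosSemidef) :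
    (N.apply ρ).PosSemidef :=
  posSemidef_sum _ fun i _ => hρ.mul_mul_conjTranspose_same (N.K i)

lemma apply_add (N : KrausFamily A B) (ρ σ : Matrix A A ℂ) :
    N.apply (ρ + σ) = N.apply ρ + N.apply σ := by
  simp [apply, Matrix.mul_add, Matrix.add_mul, Finset.sum_add_distrib]

lemma apply_smul (N : KrausFamily A B) (c : ℂ) (ρ : Matrix A A ℂ) :
    N.apply (c • ρ) = c • N.apply ρ := by
  simp [apply, Finset.smul_sum]

/-- Kadison–Schwarz inequality for the adjoint of a channel. -/
lemma IsChannel.adj_mul_conjTranspose_sub {N : KrausFamily A B} (hN : N.IsChannel)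
    (X : Matrix B B ℂ) :
    N.adj (X * Xᴴ) - N.adj X * (N.adj X)ᴴ =
      ∑ i, (Xᴴ * N.K i - N.K i * (N.adj X)ᴴ)ᴴ * (Xᴴ * N.K i - N.K i * (N.adj X)ᴴ) := by
  have h : ∀ i, (Xᴴ * N.K i - N.K i * (N.adj X)ᴴ)ᴴ * (Xᴴ * N.K i - N.K i * (N.adj X)ᴴ) =
      (N.K i)ᴴ * (X * Xᴴ) * N.K i - (N.K i)ᴴ * X * N.K i * (N.adj X)ᴴ
        - N.adj X * ((N.K i)ᴴ * Xᴴ * N.K i)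
        + N.adj X * ((N.K i)ᴴ * N.K i) * (N.adj X)ᴴ := by
    intro i
    simp only [conjTranspose_sub, conjTranspose_mul, conjTranspose_conjTranspose,
      Matrix.mul_sub, Matrix.sub_mul, Matrix.mul_assoc]
    abel
  have e1 : ∑ i, (N.K i)ᴴ * N.K i = 1 := hN
  have e2 : ∑ i, (N.K i)ᴴ * X * N.K i = N.adj X := rfl
  have e3 : ∑ i, (N.K i)ᴴ * Xᴴ * N.K i = (N.adj X)ᴴ := N.adj_conjTranspose X
  have e4 : ∑ i, (N.K i)ᴴ * (X * Xᴴ) * N.K i = N.adj (X * Xᴴ) := rfl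
  simp only [h, Finset.sum_add_distrib, Finset.sum_sub_distrib, ← Finset.sum_mul,
    ← Finset.mul_sum, e1, e2, e3, e4, mul_one]
  abel

lemma IsChannel.trace_mul_adj_le {N : KrausFamily A B} (hN : N.IsChannel)
    {σ : Matrix A A ℂ} (hσ : σ.PosSemidef) (X : Matrix B B ℂ) :
    (σ * (N.adj X * (N.adj X)ᴴ)).trace.re ≤ (N.apply σ * (X * Xᴴ)).trace.re := by
  rw [trace_apply_mul, ← sub_nonneg, ← Complex.sub_re, ← trace_sub, ← mul_sub,
    hN.adj_mul_conjTranspose_sub, Finset.mul_sum, trace_sum, Complex.re_sum]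
  exact Finset.sum_nonneg fun i _ => hσ.trace_mul_conjTranspose_mul_self_re_nonneg _

lemma IsChannel.resolventForm_apply_le {N : KrausFamily A B} (hN : N.IsChannel)
    {ρ σ : Matrix A A ℂ} (hρ : ρ.PosSemidef) (hσ : σ.PosSemidef) {t : ℝ} (ht : 0 ≤ t)
    (X : Matrix B B ℂ) :
    resolventForm t (N.apply ρ) (N.apply σ) X ≤ resolventForm t ρ σ (N.adj X) := by
  have h1 : (Xᴴ * N.apply ρ).trace = ((N.adj X)ᴴ * ρ).trace := by
    rw [trace_mul_comm, trace_apply_mul, adj_conjTranspose, trace_mul_comm]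
  have h2 := hN.trace_mul_adj_le hσ X
  have h3 := hN.trace_mul_adj_le hρ Xᴴ
  rw [adj_conjTranspose, conjTranspose_conjTranspose, conjTranspose_conjTranspose] at h3
  have h4 := mul_le_mul_of_nonneg_left h3 ht
  simp only [resolventForm, h1]
  linarith

end KrausFamily

namespace Matrix

variable {n : Type*} [Fintype n] [DecidableEq n]

lemma IsHermitian.eq_eigenvectorUnitary_mul_diagonal {ρ : Matrix n n ℂ} (h : ρ.IsHermitian) :
    ρ = (h.eigenvectorUnitary : Matrix n n ℂ) * diagonal (fun i => (h.eigenvalues i : ℂ)) *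
      (h.eigenvectorUnitary : Matrix n n ℂ)ᴴ := by
  conv_lhs => rw [h.spectral_theorem]
  rfl

lemma IsHermitian.conjTranspose_eigenvectorUnitary_mul_self {ρ : Matrix n n ℂ}
    (h : ρ.IsHermitian) :
    (h.eigenvectorUnitary : Matrix n n ℂ)ᴴ * (h.eigenvectorUnitary : Matrix n n ℂ) = 1 :=
  Unitary.coe_star_mul_self h.eigenvectorUnitary

/-- The diagonal of `ρ` in an eigenbasis of `σ`. -/
noncomputable def IsHermitian.diagIn {σ : Matrix n n ℂ} (hσ : σ.IsHermitian)
    (ρ : Matrix n n ℂ) (j : n) : ℝ :=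
  (((hσ.eigenvectorUnitary : Matrix n n ℂ)ᴴ * ρ *
    (hσ.eigenvectorUnitary : Matrix n n ℂ)) j j).re

/-- Relative entropy (natural logarithm) of `ρ` with respect to `σ`; it is only meaningful when
the support of `ρ` is contained in that of `σ`. -/
noncomputable def IsHermitian.relEntropy {ρ σ : Matrix n n ℂ} (hρ : ρ.IsHermitian)
    (hσ : σ.IsHermitian) : ℝ :=
  ∑ i, hρ.eigenvalues i * Real.log (hρ.eigenvalues i) -
    ∑ j, hσ.diagIn ρ j * Real.log (hσ.eigenvalues j)

lemma IsHermitian.diagIn_self {σ : Matrix n n ℂ} (hσ : σ.IsHermitian) (j : n) :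
    hσ.diagIn σ j = hσ.eigenvalues j := by
  have hV := hσ.conjTranspose_eigenvectorUnitary_mul_self
  have e : (hσ.eigenvectorUnitary : Matrix n n ℂ)ᴴ * σ * (hσ.eigenvectorUnitary : Matrix n n ℂ) =
      diagonal (fun i => (hσ.eigenvalues i : ℂ)) := by
    refine (congrArg (fun Z => (hσ.eigenvectorUnitary : Matrix n n ℂ)ᴴ * Z *
      (hσ.eigenvectorUnitary : Matrix n n ℂ)) hσ.eq_eigenvectorUnitary_mul_diagonal).trans ?_
    rw [← mul_assoc, ← mul_assoc, hV, one_mul, mul_assoc, hV, mul_one]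
  simp [diagIn, e]

lemma IsHermitian.diagIn_add {σ : Matrix n n ℂ} (hσ : σ.IsHermitian) (ρ τ : Matrix n n ℂ)
    (j : n) : hσ.diagIn (ρ + τ) j = hσ.diagIn ρ j + hσ.diagIn τ j := by
  simp [diagIn, mul_add, add_mul]

lemma IsHermitian.diagIn_smul {σ : Matrix n n ℂ} (hσ : σ.IsHermitian) (c : ℝ)
    (ρ : Matrix n n ℂ) (j : n) : hσ.diagIn ((c : ℂ) • ρ) j = c * hσ.diagIn ρ j := by
  simp [diagIn]

lemma IsHermitian.diagIn_nonneg {σ ρ : Matrix n n ℂ} (hσ : σ.IsHermitian)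
    (hρ : ρ.PosSemidef) (j : n) : 0 ≤ hσ.diagIn ρ j :=
  (Complex.le_def.1 (hρ.conjTranspose_mul_mul_same _).diag_nonneg).1

/-- Squared moduli of the inner products between eigenvectors of `σ` and `ρ`. -/
noncomputable def IsHermitian.overlap {ρ σ : Matrix n n ℂ} (hρ : ρ.IsHermitian)
    (hσ : σ.IsHermitian) (j i : n) : ℝ :=
  Complex.normSq (((hσ.eigenvectorUnitary : Matrix n n ℂ)ᴴ *
    (hρ.eigenvectorUnitary : Matrix n n ℂ)) j i)

lemma IsHermitian.sum_overlap {ρ σ : Matrix n n ℂ} (hρ : ρ.IsHermitian) (hσ : σ.IsHermitian)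
    (i : n) : ∑ j, hρ.overlap hσ j i = 1 := by
  have hU := hρ.conjTranspose_eigenvectorUnitary_mul_self
  have hV := hσ.conjTranspose_eigenvectorUnitary_mul_self
  rw [mul_eq_one_comm] at hV
  set U := (hρ.eigenvectorUnitary : Matrix n n ℂ) with U_def
  set V := (hσ.eigenvectorUnitary : Matrix n n ℂ) with V_def
  have h : (Vᴴ * U)ᴴ * (Vᴴ * U) = 1 := by
    rw [conjTranspose_mul, conjTranspose_conjTranspose, mul_assoc, ← mul_assoc V, hV, one_mul, hU]
  have h2 := congrArg Complex.re (congrFun (congrFun h i) i)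
  rw [mul_apply] at h2
  simpa [overlap, ← U_def, ← V_def, Complex.normSq_apply] using h2

lemma IsHermitian.diagIn_eq_sum_overlap {ρ σ : Matrix n n ℂ} (hρ : ρ.IsHermitian)
    (hσ : σ.IsHermitian) (j : n) :
    hσ.diagIn ρ j = ∑ i, hρ.overlap hσ j i * hρ.eigenvalues i := by
  unfold diagIn overlap
  set V := (hσ.eigenvectorUnitary : Matrix n n ℂ) with V_def
  conv_lhs => rw [hρ.eq_eigenvectorUnitary_mul_diagonal]
  set U := (hρ.eigenvectorUnitary : Matrix n n ℂ) with U_def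
  have e : Vᴴ * (U * diagonal (fun i => (hρ.eigenvalues i : ℂ)) * Uᴴ) * V =
      Vᴴ * U * diagonal (fun i => (hρ.eigenvalues i : ℂ)) * (Vᴴ * U)ᴴ := by
    simp only [conjTranspose_mul, conjTranspose_conjTranspose, mul_assoc]
  rw [e, mul_apply, Complex.re_sum]
  refine Finset.sum_congr rfl fun i _ => ?_
  rw [mul_diagonal, conjTranspose_apply, mul_right_comm, Complex.star_def, Complex.mul_conj,
    ← Complex.ofReal_mul, Complex.ofReal_re]

lemma IsHermitian.relEntropy_eq {ρ σ : Matrix n n ℂ} (hρ : ρ.IsHermitian) (hσ : σ.IsHermitian)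
    (hsupp : ∀ j, hσ.eigenvalues j = 0 → hσ.diagIn ρ j = 0) (hp : ρ.PosSemidef) :
    (∀ k : n × n, hσ.eigenvalues k.1 / hρ.eigenvalues k.2 = 0 →
        hρ.overlap hσ k.1 k.2 * hρ.eigenvalues k.2 = 0) ∧
      hρ.relEntropy hσ = -∑ k : n × n, hρ.overlap hσ k.1 k.2 * hρ.eigenvalues k.2 *
        Real.log (hσ.eigenvalues k.1 / hρ.eigenvalues k.2) := by
  have hz : ∀ j i, hσ.eigenvalues j = 0 → hρ.overlap hσ j i * hρ.eigenvalues i = 0 := by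
    intro j i hj
    have h := hsupp j hj
    rw [hρ.diagIn_eq_sum_overlap hσ, Finset.sum_eq_zero_iff_of_nonneg] at h
    · exact h i (Finset.mem_univ i)
    · exact fun i _ => mul_nonneg (Complex.normSq_nonneg _) (hp.eigenvalues_nonneg i)
  constructor
  · rintro ⟨j, i⟩ h
    rcases div_eq_zero_iff.1 h with h | h
    · exact hz j i h
    · simp [h]
  · have key : ∀ j i, hρ.overlap hσ j i * hρ.eigenvalues i *
        Real.log (hσ.eigenvalues j / hρ.eigenvalues i) =
        hρ.overlap hσ j i * hρ.eigenvalues i * Real.log (hσ.eigenvalues j) -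
        hρ.overlap hσ j i * (hρ.eigenvalues i * Real.log (hρ.eigenvalues i)) := by
      intro j i
      by_cases h1 : hρ.eigenvalues i = 0
      · simp [h1]
      by_cases h2 : hσ.eigenvalues j = 0
      · have h3 := hz j i h2
        rw [← mul_assoc, h3]
        simp
      · rw [Real.log_div h2 h1]
        ring
    rw [Fintype.sum_prod_type]
    simp only [key, Finset.sum_sub_distrib]
    rw [Finset.sum_comm (f := fun j i => hρ.overlap hσ j i * (hρ.eigenvalues i * _))]
    simp only [← Finset.sum_mul, hρ.sum_overlap hσ, one_mul, ← hρ.diagIn_eq_sum_overlap hσ,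
      relEntropy]
    ring

lemma IsHermitian.sum_overlap_mul_eigenvalues {ρ σ : Matrix n n ℂ} (hρ : ρ.IsHermitian)
    (hσ : σ.IsHermitian) :
    ∑ k : n × n, hρ.overlap hσ k.1 k.2 * hρ.eigenvalues k.2 = ρ.trace.re := by
  rw [Fintype.sum_prod_type, Finset.sum_comm]
  simp only [← Finset.sum_mul, hρ.sum_overlap hσ, one_mul, hρ.trace_eq_sum_eigenvalues]
  simp

end Matrix

open Matrix in
/-- Data processing inequality for the relative entropy. -/
lemma KrausFamily.IsChannel.relEntropy_apply_le {N : KrausFamily A B} (hN : N.IsChannel)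
    {ρ σ : Matrix A A ℂ} (hρ : ρ.PosSemidef) (hσ : σ.PosSemidef)
    (hρ' : (N.apply ρ).IsHermitian) (hσ' : (N.apply σ).IsHermitian)
    (hsupp : ∀ j, hσ.isHermitian.eigenvalues j = 0 → hσ.isHermitian.diagIn ρ j = 0)
    (hsupp' : ∀ j, hσ'.eigenvalues j = 0 → hσ'.diagIn (N.apply ρ) j = 0) :
    hρ'.relEntropy hσ' ≤ hρ.isHermitian.relEntropy hσ.isHermitian := by
  have pρ := N.apply_posSemidef_s7 hρ
  have pσ := N.apply_posSemidef_s7 hσ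
  obtain ⟨z, e⟩ := hρ.isHermitian.relEntropy_eq hσ.isHermitian hsupp hρ
  obtain ⟨z', e'⟩ := hρ'.relEntropy_eq hσ' hsupp' pρ
  rw [e, e', neg_le_neg_iff]
  refine sum_mul_log_le_of_sum_div_le
    (fun k => div_nonneg (pσ.eigenvalues_nonneg k.1) (pρ.eigenvalues_nonneg k.2))
    (fun k => div_nonneg (hσ.eigenvalues_nonneg k.1) (hρ.eigenvalues_nonneg k.2)) z' z ?_ ?_
  · rw [IsHermitian.sum_overlap_mul_eigenvalues, IsHermitian.sum_overlap_mul_eigenvalues,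
      hN.trace_apply_s7]
  · intro t ht
    obtain ⟨X, hX⟩ := exists_resolventForm_eq hρ'.conjTranspose_eigenvectorUnitary_mul_self
      hσ'.conjTranspose_eigenvectorUnitary_mul_self pρ.eigenvalues_nonneg pσ.eigenvalues_nonneg ht
    rw [← hρ'.eq_eigenvectorUnitary_mul_diagonal, ← hσ'.eq_eigenvectorUnitary_mul_diagonal] at hX
    have h1 := hN.resolventForm_apply_le hρ hσ ht.le X
    have h2 := resolventForm_le hρ.isHermitian.conjTranspose_eigenvectorUnitary_mul_self
      hσ.isHermitian.conjTranspose_eigenvectorUnitary_mul_self hρ.eigenvalues_nonneg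
      hσ.eigenvalues_nonneg ht (N.adj X)
    rw [← hρ.isHermitian.eq_eigenvectorUnitary_mul_diagonal,
      ← hσ.isHermitian.eq_eigenvectorUnitary_mul_diagonal] at h2
    rw [Fintype.sum_prod_type, Fintype.sum_prod_type]
    exact hX.symm.trans_le (h1.trans h2)

/-- Von Neumann entropy through natural logarithms. -/
lemma Matrix.IsHermitian.vnEntropy_mul_log_two {n : Type} [Fintype n] [DecidableEq n]
    {ρ : Matrix n n ℂ} (h : ρ.IsHermitian) :
    vnEntropy ρ * Real.log 2 = -∑ i, h.eigenvalues i * Real.log (h.eigenvalues i) := by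
  have h2 : Real.log 2 ≠ 0 := (Real.log_pos one_lt_two).ne'
  rw [vnEntropy, dif_pos h, neg_mul, Finset.sum_mul]
  congr 1
  refine Finset.sum_congr rfl fun i _ => ?_
  rw [Real.logb]
  field_simp

/-- The Holevo quantity of a two-state ensemble as an average of relative entropies. -/
lemma Matrix.IsHermitian.holevo_eq_relEntropy {n : Type} [Fintype n] [DecidableEq n]
    {ρ₀ ρ₁ σ : Matrix n n ℂ} (h₀ : ρ₀.IsHermitian) (h₁ : ρ₁.IsHermitian) (hσ : σ.IsHermitian)
    {a b : ℝ} (e : σ = (a : ℂ) • ρ₀ + (b : ℂ) • ρ₁) :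
    (vnEntropy σ - (a * vnEntropy ρ₀ + b * vnEntropy ρ₁)) * Real.log 2 =
      a * h₀.relEntropy hσ + b * h₁.relEntropy hσ := by
  have hq : ∀ j, a * hσ.diagIn ρ₀ j + b * hσ.diagIn ρ₁ j = hσ.eigenvalues j := by
    intro j
    rw [← diagIn_smul, ← diagIn_smul, ← diagIn_add, ← e, diagIn_self]
  have hs : a * ∑ j, hσ.diagIn ρ₀ j * Real.log (hσ.eigenvalues j) +
      b * ∑ j, hσ.diagIn ρ₁ j * Real.log (hσ.eigenvalues j) =
      ∑ j, hσ.eigenvalues j * Real.log (hσ.eigenvalues j) := by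
    rw [Finset.mul_sum, Finset.mul_sum, ← Finset.sum_add_distrib]
    refine Finset.sum_congr rfl fun j _ => ?_
    rw [← mul_assoc, ← mul_assoc, ← add_mul, hq]
  rw [sub_mul, add_mul, mul_assoc, mul_assoc, h₀.vnEntropy_mul_log_two, h₁.vnEntropy_mul_log_two,
    hσ.vnEntropy_mul_log_two, relEntropy, relEntropy]
  linear_combination hs

lemma Matrix.IsHermitian.diagIn_eq_zero_of_eigenvalues_eq_zero {n : Type*} [Fintype n]
    [DecidableEq n] {ρ₀ ρ₁ σ : Matrix n n ℂ} (h₀ : ρ₀.PosSemidef) (h₁ : ρ₁.PosSemidef)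
    (hσ : σ.IsHermitian) {a b : ℝ} (ha : 0 < a) (hb : 0 < b)
    (e : σ = (a : ℂ) • ρ₀ + (b : ℂ) • ρ₁) (j : n) (hj : hσ.eigenvalues j = 0) :
    hσ.diagIn ρ₀ j = 0 ∧ hσ.diagIn ρ₁ j = 0 := by
  have hq : a * hσ.diagIn ρ₀ j + b * hσ.diagIn ρ₁ j = 0 := by
    rw [← diagIn_smul, ← diagIn_smul, ← diagIn_add, ← e, diagIn_self, hj]
  have d₀ := hσ.diagIn_nonneg h₀ j
  have d₁ := hσ.diagIn_nonneg h₁ j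
  rw [add_eq_zero_iff_of_nonneg (by positivity) (by positivity)] at hq
  simpa [ha.ne', hb.ne'] using hq

open Matrix in
/-- Channels do not increase the Holevo quantity of a two-state ensemble. -/
lemma KrausFamily.IsChannel.holevo_apply_le {N : KrausFamily A B} (hN : N.IsChannel)
    {ρ₀ ρ₁ : Matrix A A ℂ} (h₀ : ρ₀.PosSemidef) (h₁ : ρ₁.PosSemidef) {a b : ℝ}
    (ha : 0 < a) (hb : 0 < b) :
    vnEntropy (N.apply ((a : ℂ) • ρ₀ + (b : ℂ) • ρ₁)) -
        (a * vnEntropy (N.apply ρ₀) + b * vnEntropy (N.apply ρ₁)) ≤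
      vnEntropy ((a : ℂ) • ρ₀ + (b : ℂ) • ρ₁) - (a * vnEntropy ρ₀ + b * vnEntropy ρ₁) := by
  have hσ : ((a : ℂ) • ρ₀ + (b : ℂ) • ρ₁).PosSemidef :=
    (h₀.smul (Complex.zero_le_real.2 ha.le)).add (h₁.smul (Complex.zero_le_real.2 hb.le))
  have e : N.apply ((a : ℂ) • ρ₀ + (b : ℂ) • ρ₁) =
      (a : ℂ) • N.apply ρ₀ + (b : ℂ) • N.apply ρ₁ := by
    rw [apply_add, apply_smul, apply_smul]
  have p₀ := N.apply_posSemidef_s7 h₀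
  have p₁ := N.apply_posSemidef_s7 h₁
  have pσ := N.apply_posSemidef_s7 hσ
  have s := IsHermitian.diagIn_eq_zero_of_eigenvalues_eq_zero h₀ h₁ hσ.isHermitian ha hb rfl
  have s' := IsHermitian.diagIn_eq_zero_of_eigenvalues_eq_zero p₀ p₁ pσ.isHermitian ha hb e
  refine le_of_mul_le_mul_right ?_ (Real.log_pos one_lt_two)
  rw [IsHermitian.holevo_eq_relEntropy p₀.isHermitian p₁.isHermitian pσ.isHermitian e,
    IsHermitian.holevo_eq_relEntropy h₀.isHermitian h₁.isHermitian hσ.isHermitian rfl]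
  have r₀ := hN.relEntropy_apply_le h₀ hσ p₀.isHermitian pσ.isHermitian
    (fun j hj => (s j hj).1) (fun j hj => (s' j hj).1)
  have r₁ := hN.relEntropy_apply_le h₁ hσ p₁.isHermitian pσ.isHermitian
    (fun j hj => (s j hj).2) (fun j hj => (s' j hj).2)
  gcongr

/-- For a degradable quantum channel `N`, the coherent information
`I^c(N, φ)` is concave in the input density matrix `φ`. -/
theorem cohInfo_concave_of_degradable
    {A B : Type} [Fintype A] [DecidableEq A] [Fintype B] [DecidableEq B]
    (N : KrausFamily A B) (hN : N.IsChannel) (hdeg : N.IsDegradable)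
    (φ0 φ1 : Matrix A A ℂ) (h0 : IsDensity φ0) (h1 : IsDensity φ1)
    (p : ℝ) (hp0 : 0 ≤ p) (hp1 : p ≤ 1) :
    p * cohInfo N φ0 + (1 - p) * cohInfo N φ1 ≤
      cohInfo N ((p : ℂ) • φ0 + ((1 - p : ℝ) : ℂ) • φ1) := by
  rcases hp0.eq_or_lt with rfl | hp0
  · simp
  rcases hp1.eq_or_lt with rfl | hp1
  · simp
  obtain ⟨D, hD, hND⟩ := hdeg
  have key := hD.holevo_apply_le (N.apply_posSemidef_s7 h0.1) (N.apply_posSemidef_s7 h1.1) hp0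
    (sub_pos.2 hp1)
  rw [← N.apply_smul, ← N.apply_smul, ← N.apply_add, hND, hND, hND] at key
  simp only [cohInfo]
  linarith
end
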